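/- arXiv:1109.1337 — 9 statements merged into one kernel-verified Lean document; each statement's English description precedes it below -/
import Mathlib

section
/- Let Γ be a tail-triangle C-group of rank n+1, fix Γ_n to be one of Γ_n^P or Γ_n^Q, and let 0 ≤ j_1 < j_2 < … < j_m ≤ n. Suppose μ_{j_1}, …, μ_{j_m} ∈ Γ satisfy Γ_{j_i}μ_{j_i} ∩ Γ_{j_{i+1}}μ_{j_{i+1}} ≠ ∅ for 1 ≤ i < m (right cosets). Then there exists a common element μ ∈ Γ such that Γ_{j_i}μ_{j_i} = Γ_{j_i}μ for all 1 ≤ i ≤ m. -/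
/-!
Tail-triangle C-groups (Monson–Schulte, "Semiregular Polytopes and Amalgamated C-groups").

A tail-triangle group of rank `n+1` (`n ≥ 2`) is a group `G` generated by involutions
`α 0, …, α (n-1), β` (where `β` plays the role of `β_{n-1}`), with the commutation
relations of the tail-triangle diagram, and it is a tail-triangle C-group if it moreover
satisfies the intersection condition on its distinguished generating family.
The generating family is indexed by `Set.Iic n ⊆ ℕ`, with index `i < n` corresponding
to `α i` and index `n` corresponding to `β`.
-/

namespace TailTriangle

variable {G : Type*} [Group G]

/-- The combined generating family: index `i < n` gives `α i`, index `n` (or beyond) gives `β`. -/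
def ttGens (n : ℕ) (α : ℕ → G) (β : G) : ℕ → G := fun i => if i < n then α i else β

/-- The intersection condition on the generating family, for subsets of the index set `Iic n`. -/
def ttInterCond (n : ℕ) (α : ℕ → G) (β : G) : Prop :=
  ∀ I J : Set ℕ, I ⊆ Set.Iic n → J ⊆ Set.Iic n →
    Subgroup.closure (ttGens n α β '' I) ⊓ Subgroup.closure (ttGens n α β '' J)
      = Subgroup.closure (ttGens n α β '' (I ∩ J))

/-- A tail-triangle group of rank `n+1`. -/
structure IsTailTriangleGroup (n : ℕ) (α : ℕ → G) (β : G) : Prop where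
  two_le : 2 ≤ n
  orderOf_α : ∀ i < n, orderOf (α i) = 2
  orderOf_β : orderOf β = 2
  comm_αα : ∀ i j : ℕ, i + 2 ≤ j → j < n → Commute (α i) (α j)
  comm_αβ : ∀ i : ℕ, i + 3 ≤ n → Commute (α i) β
  closure_eq_top : Subgroup.closure (ttGens n α β '' Set.Iic n) = ⊤

/-- A tail-triangle C-group: a tail-triangle group satisfying the intersection condition. -/
def IsTailTriangleCGroup (n : ℕ) (α : ℕ → G) (β : G) : Prop :=
  IsTailTriangleGroup n α β ∧ ttInterCond n α β

/-- The distinguished subgroup `Γ_j` of rank `j`, for `0 ≤ j ≤ n-1`: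
for `j ≤ n-2` it is generated by all generators except `α j`;
`Γ_{n-1}` is generated by `α 0, …, α (n-2)`. -/
def ttΓ (n : ℕ) (α : ℕ → G) (β : G) (j : ℕ) : Subgroup G :=
  if j = n - 1 then Subgroup.closure (ttGens n α β '' {i | i < n - 1})
  else Subgroup.closure (ttGens n α β '' {i | i ≤ n ∧ i ≠ j})

/-- `Γ_n^P = ⟨α 0, …, α (n-1)⟩`. -/
def ttΓP (n : ℕ) (α : ℕ → G) (β : G) : Subgroup G :=
  Subgroup.closure (ttGens n α β '' {i | i < n})

/-- `Γ_n^Q = ⟨α 0, …, α (n-2), β⟩`. -/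
def ttΓQ (n : ℕ) (α : ℕ → G) (β : G) : Subgroup G :=
  Subgroup.closure (ttGens n α β '' {i | i ≤ n ∧ i ≠ n - 1})

/-- The rank-`j` subgroup where the Boolean `P` chooses `Γ_n^P` (if `true`) or `Γ_n^Q`
(if `false`) at rank `n`. -/
def ttΓ' (n : ℕ) (α : ℕ → G) (β : G) (P : Bool) (j : ℕ) : Subgroup G :=
  if j = n then (if P then ttΓP n α β else ttΓQ n α β) else ttΓ n α β j

/-- The right coset `H μ = {h * μ : h ∈ H}`. -/
def rcoset (H : Subgroup G) (μ : G) : Set G := (· * μ) '' (H : Set G)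

theorem rcoset_eq_rcoset {H : Subgroup G} {μ ν : G} (h : ν * μ⁻¹ ∈ H) :
    rcoset H μ = rcoset H ν := by
  ext x
  simp only [rcoset, Set.mem_image, SetLike.mem_coe]
  constructor
  · rintro ⟨g, hg, rfl⟩
    exact ⟨g * (ν * μ⁻¹)⁻¹, H.mul_mem hg (H.inv_mem h), by group⟩
  · rintro ⟨g, hg, rfl⟩
    exact ⟨g * (ν * μ⁻¹), H.mul_mem hg h, by group⟩

/-- The subgroup generated by the union of two elementwise commuting sets is the product
of the subgroups they generate. -/
theorem exists_mul_of_mem_closure_union {A B : Set G} (hAB : ∀ a ∈ A, ∀ b ∈ B, Commute a b)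
    {g : G} (hg : g ∈ Subgroup.closure (A ∪ B)) :
    ∃ l ∈ Subgroup.closure A, ∃ r ∈ Subgroup.closure B, g = l * r := by
  have hcomm : ∀ l ∈ Subgroup.closure A, ∀ r ∈ Subgroup.closure B, Commute l r := by
    have hB : Subgroup.closure B ≤ Subgroup.centralizer A := by
      rw [Subgroup.closure_le]
      intro b hb
      exact Subgroup.mem_centralizer_iff.2 fun a ha => hAB a ha b hb
    have hA : Subgroup.closure A ≤ Subgroup.centralizer (Subgroup.closure B : Set G) := by
      rw [Subgroup.closure_le]
      intro a ha
      exact Subgroup.mem_centralizer_iff.2 fun r hr =>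
        (Subgroup.mem_centralizer_iff.1 (hB hr) a ha).symm
    exact fun l hl r hr => (Subgroup.mem_centralizer_iff.1 (hA hl) r hr).symm
  induction hg using Subgroup.closure_induction with
  | mem x hx =>
    rcases hx with hx | hx
    · exact ⟨x, Subgroup.subset_closure hx, 1, one_mem _, (mul_one x).symm⟩
    · exact ⟨1, one_mem _, x, Subgroup.subset_closure hx, (one_mul x).symm⟩
  | one => exact ⟨1, one_mem _, 1, one_mem _, (one_mul 1).symm⟩
  | mul x y _ _ hx hy =>
    obtain ⟨l, hl, r, hr, rfl⟩ := hx
    obtain ⟨l', hl', r', hr', rfl⟩ := hy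
    exact ⟨l * l', mul_mem hl hl', r * r', mul_mem hr hr',
      (hcomm l' hl' r hr).symm.mul_mul_mul_comm l r'⟩
  | inv x _ hx =>
    obtain ⟨l, hl, r, hr, rfl⟩ := hx
    exact ⟨l⁻¹, inv_mem hl, r⁻¹, inv_mem hr, by rw [(hcomm l hl r hr).eq, mul_inv_rev]⟩

theorem commute_ttGens {n : ℕ} {α : ℕ → G} {β : G} (h : IsTailTriangleGroup n α β)
    {i p k : ℕ} (hip : i < p) (hpk : p < k) (hp : p + 2 ≤ n) :
    Commute (ttGens n α β i) (ttGens n α β k) := by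
  unfold ttGens
  rw [if_pos (by omega)]
  split_ifs with hk
  · exact h.comm_αα i k (by omega) hk
  · exact h.comm_αβ i (by omega)

theorem ttΓ'_of_add_two_le {n : ℕ} (α : ℕ → G) (β : G) (P : Bool) {p : ℕ} (hp : p + 2 ≤ n) :
    ttΓ' n α β P p = Subgroup.closure (ttGens n α β '' {i | i ≤ n ∧ i ≠ p}) := by
  rw [ttΓ', if_neg (by omega), ttΓ, if_neg (by omega)]

theorem closure_lt_le_ttΓ' {n : ℕ} (α : ℕ → G) (β : G) (P : Bool) {p q : ℕ}
    (hp : p + 1 ≤ n) (hpq : p < q) (hq : q ≤ n) :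
    Subgroup.closure (ttGens n α β '' {i | i < p}) ≤ ttΓ' n α β P q := by
  unfold ttΓ' ttΓ ttΓP ttΓQ
  split_ifs <;>
  · refine Subgroup.closure_mono (Set.image_mono fun i hi => ?_)
    simp only [Set.mem_ofPred_eq] at hi ⊢
    omega

/-- An element of `Γ_p` factors into an element of `Γ_q`, for given `q > p`, and an element
lying in every `Γ_s` with `s ≤ p`. -/
theorem exists_mul_of_mem_ttΓ' {n : ℕ} {α : ℕ → G} {β : G} (h : IsTailTriangleGroup n α β)
    (P : Bool) {p q : ℕ} (hpq : p < q) (hq : q ≤ n) {g : G} (hg : g ∈ ttΓ' n α β P p) :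
    ∃ l ∈ ttΓ' n α β P q, ∃ r, (∀ s ≤ p, r ∈ ttΓ' n α β P s) ∧ g = l * r := by
  by_cases hp : p + 2 ≤ n
  · have hsplit : {i | i ≤ n ∧ i ≠ p} = {i | i < p} ∪ {i | p < i ∧ i ≤ n} := by
      ext i
      simp only [Set.mem_ofPred_eq, Set.mem_union]
      omega
    rw [ttΓ'_of_add_two_le α β P hp, hsplit, Set.image_union] at hg
    obtain ⟨l, hl, r, hr, rfl⟩ := exists_mul_of_mem_closure_union (by
      rintro _ ⟨i, hi, rfl⟩ _ ⟨k, hk, rfl⟩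
      exact commute_ttGens h hi hk.1 hp) hg
    refine ⟨l, closure_lt_le_ttΓ' α β P (by omega) hpq hq hl, r, fun s hs => ?_, rfl⟩
    rw [ttΓ'_of_add_two_le α β P (by omega)]
    refine Subgroup.closure_mono (Set.image_mono fun i hi => ?_) hr
    simp only [Set.mem_ofPred_eq] at hi ⊢
    omega
  · have hpn : p = n - 1 := by omega
    rw [ttΓ', if_neg (by omega), ttΓ, if_pos hpn, ← hpn] at hg
    exact ⟨g, closure_lt_le_ttΓ' α β P (by omega) hpq hq hg, 1, fun _ _ => one_mem _,
      (mul_one g).symm⟩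

/-- Lemma `dist`(c): if consecutive members of a chain of right cosets of distinguished
subgroups of strictly increasing ranks `j 0 < j 1 < … < j (m-1) ≤ n` intersect pairwise,
then there is a common coset representative `ν`. -/
theorem common_coset_representative
    (n : ℕ) (α : ℕ → G) (β : G) (h : IsTailTriangleCGroup n α β) (P : Bool)
    (m : ℕ) (j : Fin m → ℕ) (hmono : StrictMono j) (hle : ∀ i, j i ≤ n)
    (μ : Fin m → G)
    (hint : ∀ (i : ℕ) (h1 : i + 1 < m),
      (rcoset (ttΓ' n α β P (j ⟨i, by omega⟩)) (μ ⟨i, by omega⟩) ∩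
        rcoset (ttΓ' n α β P (j ⟨i + 1, h1⟩)) (μ ⟨i + 1, h1⟩)).Nonempty) :
    ∃ ν : G, ∀ i : Fin m,
      rcoset (ttΓ' n α β P (j i)) (μ i) = rcoset (ttΓ' n α β P (j i)) ν := by
  have key : ∀ (t : ℕ) (ht : t < m), ∃ ν : G, ∀ (i : ℕ) (hi : i ≤ t),
      ν * (μ ⟨i, by omega⟩)⁻¹ ∈ ttΓ' n α β P (j ⟨i, by omega⟩) := by
    intro t
    induction t with
    | zero =>
      intro ht
      refine ⟨μ ⟨0, ht⟩, fun i hi => ?_⟩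
      obtain rfl : i = 0 := by omega
      rw [mul_inv_cancel]
      exact one_mem _
    | succ t ih =>
      intro ht
      obtain ⟨ν, hν⟩ := ih (by omega)
      obtain ⟨x, ⟨a, ha, hax⟩, ⟨b, hb, hbx⟩⟩ := hint t ht
      have hab : a * μ ⟨t, by omega⟩ = b * μ ⟨t + 1, ht⟩ := hax.trans hbx.symm
      obtain ⟨l, hl, r, hr, hlr⟩ := exists_mul_of_mem_ttΓ' h.1 P
        (hmono (Fin.mk_lt_mk.2 (Nat.lt_succ_self t))) (hle ⟨t + 1, ht⟩)
        (mul_mem ha (inv_mem (hν t le_rfl)))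
      refine ⟨r * ν, fun i hi => ?_⟩
      rcases Nat.lt_or_ge t i with hti | hit
      · obtain rfl : i = t + 1 := by omega
        have hrν : r * ν * (μ ⟨t + 1, ht⟩)⁻¹ = l⁻¹ * b := by
          rw [mul_inv_eq_iff_eq_mul, mul_assoc l⁻¹, ← hab, eq_inv_mul_iff_mul_eq, ← mul_assoc,
            ← hlr]
          group
        rw [hrν]
        exact mul_mem (inv_mem hl) hb
      · rw [mul_assoc]
        exact mul_mem (hr _ (hmono.monotone (Fin.mk_le_mk.2 hit))) (hν i hit)
  rcases Nat.eq_zero_or_pos m with rfl | hm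
  · exact ⟨1, fun i => i.elim0⟩
  · obtain ⟨ν, hν⟩ := key (m - 1) (by omega)
    exact ⟨ν, fun i => rcoset_eq_rcoset (hν i (by omega))⟩
end TailTriangle
end

section
/- Let Γ be a tail-triangle C-group of rank n+1. Consider the graph whose vertex set consists of all right cosets of Γ_n^P together with all right cosets of Γ_n^Q, two such facet-cosets F and F′ being adjacent if and only if there exists ν ∈ Γ with Γ_{n−1}ν ∩ F ≠ ∅ and Γ_{n−1}ν ∩ F′ ≠ ∅ (they are incident with a common ridge-coset). Then this graph is connected: every facet-coset is joined to the coset Γ_n^P = Γ_n^P·1 by a finite path. -/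
/-!
Tail-triangle C-groups (Monson–Schulte, "Semiregular Polytopes and Amalgamated C-groups").

A tail-triangle group of rank `n+1` (`n ≥ 2`) is a group `G` generated by involutions
`α 0, …, α (n-1), β` (where `β` plays the role of `β_{n-1}`), with the commutation
relations of the tail-triangle diagram, and it is a tail-triangle C-group if it moreover
satisfies the intersection condition on its distinguished generating family.
The generating family is indexed by `Set.Iic n ⊆ ℕ`, with index `i < n` corresponding
to `α i` and index `n` corresponding to `β`.
-/

namespace TailTriangle

variable {G : Type*} [Group G]

theorem mem_rcoset_self (H : Subgroup G) (x : G) : x ∈ rcoset H x :=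
  ⟨1, H.one_mem, one_mul x⟩

theorem rcoset_mul_of_mem {H : Subgroup G} {g : G} (hg : g ∈ H) (x : G) :
    rcoset H (g * x) = rcoset H x := by
  ext y
  constructor
  · rintro ⟨k, hk, rfl⟩
    exact ⟨k * g, H.mul_mem hk hg, mul_assoc k g x⟩
  · rintro ⟨k, hk, rfl⟩
    exact ⟨k * g⁻¹, H.mul_mem hk (H.inv_mem hg), by simp [mul_assoc]⟩

/-- If `H` and `K` generate the group and `r` links `H x` with `K x` in both directions
for every `x`, then every right coset of `H` is joined to `H 1`. -/
theorem reflTransGen_rcoset_of_sup_eq_top {H K : Subgroup G} (hHK : H ⊔ K = ⊤)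
    {r : Set G → Set G → Prop} (hr : ∀ x, r (rcoset H x) (rcoset K x))
    (hr' : ∀ x, r (rcoset K x) (rcoset H x)) (x : G) :
    Relation.ReflTransGen r (rcoset H x) (rcoset H 1) := by
  have hstep : ∀ g ∈ (H : Set G) ∪ K, ∀ y,
      Relation.ReflTransGen r (rcoset H (g * y)) (rcoset H y) := by
    rintro g (hg | hg) y
    · rw [rcoset_mul_of_mem hg]
    · have h := hr (g * y)
      rw [rcoset_mul_of_mem hg] at h
      exact .head h (.single (hr' y))
  have hx : x ∈ Subgroup.closure ((H : Set G) ∪ K) := by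
    rw [← Subgroup.sup_eq_closure, hHK]
    trivial
  induction hx using Subgroup.closure_induction_left with
  | one => exact .refl
  | mul_left g hg y _ ih => exact (hstep g hg y).trans ih
  | inv_mul_cancel g hg y _ ih =>
    exact (hstep g⁻¹ (hg.imp H.inv_mem K.inv_mem) y).trans ih

/-- The coset graph of `reflTransGen_rcoset_of_sup_eq_top` is connected: right cosets of
either subgroup are joined to `H 1`. -/
theorem reflTransGen_of_rcoset_or_rcoset {H K : Subgroup G} (hHK : H ⊔ K = ⊤)
    {r : Set G → Set G → Prop} (hr : ∀ x, r (rcoset H x) (rcoset K x))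
    (hr' : ∀ x, r (rcoset K x) (rcoset H x)) {F : Set G}
    (hF : (∃ x, F = rcoset H x) ∨ ∃ x, F = rcoset K x) :
    Relation.ReflTransGen r F (rcoset H 1) := by
  rcases hF with ⟨x, rfl⟩ | ⟨x, rfl⟩
  · exact reflTransGen_rcoset_of_sup_eq_top hHK hr hr' x
  · exact .head (hr' x) (reflTransGen_rcoset_of_sup_eq_top hHK hr hr' x)

theorem IsTailTriangleGroup.ttΓP_sup_ttΓQ {n : ℕ} {α : ℕ → G} {β : G}
    (h : IsTailTriangleGroup n α β) : ttΓP n α β ⊔ ttΓQ n α β = ⊤ := by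
  rw [ttΓP, ttΓQ, ← Subgroup.closure_union, ← Set.image_union, eq_top_iff,
    ← h.closure_eq_top]
  refine Subgroup.closure_mono (Set.image_mono fun i hi => ?_)
  have := h.two_le
  simp only [Set.mem_Iic, Set.mem_union, Set.mem_ofPred_eq] at hi ⊢
  omega

/-- Connectedness of the facet graph: every facet-coset (a right coset of `Γ_n^P` or of
`Γ_n^Q`) is joined to the base facet `Γ_n^P · 1` by a finite path, where two facet-cosets
are adjacent when some ridge-coset `Γ_{n-1} ν` meets both. -/
theorem facet_graph_connected
    (n : ℕ) (α : ℕ → G) (β : G) (h : IsTailTriangleCGroup n α β) :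
    ∀ F : Set G,
      ((∃ μ : G, F = rcoset (ttΓP n α β) μ) ∨ (∃ μ : G, F = rcoset (ttΓQ n α β) μ)) →
      Relation.ReflTransGen
        (fun F₁ F₂ : Set G =>
          ((∃ μ : G, F₁ = rcoset (ttΓP n α β) μ) ∨ (∃ μ : G, F₁ = rcoset (ttΓQ n α β) μ)) ∧
          ((∃ μ : G, F₂ = rcoset (ttΓP n α β) μ) ∨ (∃ μ : G, F₂ = rcoset (ttΓQ n α β) μ)) ∧
          ∃ ν : G, (rcoset (ttΓ n α β (n - 1)) ν ∩ F₁).Nonempty ∧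
            (rcoset (ttΓ n α β (n - 1)) ν ∩ F₂).Nonempty)
        F (rcoset (ttΓP n α β) 1) := by
  have hmeet : ∀ (H : Subgroup G) (x : G),
      (rcoset (ttΓ n α β (n - 1)) x ∩ rcoset H x).Nonempty :=
    fun H x => ⟨x, mem_rcoset_self _ x, mem_rcoset_self H x⟩
  refine fun F hF => reflTransGen_of_rcoset_or_rcoset h.1.ttΓP_sup_ttΓQ
    (fun x => ?_) (fun x => ?_) hF
  · exact ⟨.inl ⟨x, rfl⟩, .inr ⟨x, rfl⟩, x, hmeet _ x, hmeet _ x⟩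
  · exact ⟨.inr ⟨x, rfl⟩, .inl ⟨x, rfl⟩, x, hmeet _ x, hmeet _ x⟩
end TailTriangle
end

section
/- Let Γ = ⟨α_0, …, α_{n−2}, α_{n−1}, β_{n−1}⟩ be a tail-triangle group with n ≥ 2, and set Γ_n^1 := ⟨α_0,…,α_{n−2},α_{n−1}⟩, Γ_n^2 := ⟨α_0,…,α_{n−2},β_{n−1}⟩, Γ_0 := ⟨α_1,…,α_{n−2},α_{n−1},β_{n−1}⟩, and Γ_i^+ := ⟨α_{i+1},…,α_{n−2},α_{n−1},β_{n−1}⟩ for i = 0,…,n−2. Suppose that Γ_n^1 and Γ_n^2 (with generators in the listed order) are string C-groups and that Γ_0 (as a tail-triangle group of rank n on its listed generators) satisfies the intersection condition. Then Γ satisfies the intersection condition (i.e., Γ is a tail-triangle C-group) if and only if Γ_n^1 ∩ Γ_n^2 = ⟨α_0,…,α_{n−2}⟩ and, for each i = 0,…,n−2, both Γ_i^+ ∩ Γ_n^1 = ⟨α_{i+1},…,α_{n−1}⟩ and Γ_i^+ ∩ Γ_n^2 = ⟨α_{i+1},…,α_{n−2},β_{n−1}⟩. -/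
/-!
Tail-triangle C-groups (Monson–Schulte, "Semiregular Polytopes and Amalgamated C-groups").

A tail-triangle group of rank `n+1` (`n ≥ 2`) is a group `G` generated by involutions
`α 0, …, α (n-1), β` (where `β` plays the role of `β_{n-1}`), with the commutation
relations of the tail-triangle diagram, and it is a tail-triangle C-group if it moreover
satisfies the intersection condition on its distinguished generating family.
The generating family is indexed by `Set.Iic n ⊆ ℕ`, with index `i < n` corresponding
to `α i` and index `n` corresponding to `β`.
-/

namespace TailTriangle

variable {G : Type*} [Group G]

/-- The intersection condition for a string (Coxeter-like) generating family
`ρ 0, …, ρ (n-1)`, over subsets of the index set `Iio n`. -/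
def stringInterCond (n : ℕ) (ρ : ℕ → G) : Prop :=
  ∀ I J : Set ℕ, I ⊆ Set.Iio n → J ⊆ Set.Iio n →
    Subgroup.closure (ρ '' I) ⊓ Subgroup.closure (ρ '' J)
      = Subgroup.closure (ρ '' (I ∩ J))

/-- A family `ρ 0, …, ρ (n-1)` of involutions with string diagram satisfying the
intersection condition (the generated subgroup is then a string C-group on these
generators). -/
structure IsStringCFamily (n : ℕ) (ρ : ℕ → G) : Prop where
  orderOf_gen : ∀ i < n, orderOf (ρ i) = 2
  comm : ∀ i j : ℕ, i + 2 ≤ j → j < n → Commute (ρ i) (ρ j)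
  inter : stringInterCond n ρ

theorem exists_mul_of_mem_closure_image_of_commute {ι : Type*} {g : ι → G} {A B : Set ι}
    (hAB : ∀ a ∈ A, ∀ b ∈ B, Commute (g a) (g b)) {x : G}
    (hx : x ∈ Subgroup.closure (g '' (A ∪ B))) :
    ∃ c ∈ Subgroup.closure (g '' A), ∃ d ∈ Subgroup.closure (g '' B), c * d = x := by
  have hcent : Subgroup.closure (g '' A) ≤
      Subgroup.centralizer (Subgroup.closure (g '' B) : Set G) := by
    rw [Subgroup.centralizer_closure, Subgroup.closure_le]
    rintro _ ⟨a, ha, rfl⟩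
    rw [SetLike.mem_coe, Subgroup.mem_centralizer_iff]
    rintro _ ⟨b, hb, rfl⟩
    exact (hAB a ha b hb).symm.eq
  have hcomm : ∀ (c : Subgroup.closure (g '' A)) (d : Subgroup.closure (g '' B)),
      Commute ((Subgroup.closure (g '' A)).subtype c) ((Subgroup.closure (g '' B)).subtype d) :=
    fun c d => (Subgroup.mem_centralizer_iff.1 (hcent c.2) d d.2).symm
  have hrange := MonoidHom.noncommCoprod_range _ _ hcomm
  rw [Subgroup.range_subtype, Subgroup.range_subtype, ← Subgroup.closure_union,
    ← Set.image_union] at hrange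
  rw [← hrange] at hx
  obtain ⟨⟨c, d⟩, rfl⟩ := hx
  exact ⟨c, c.2, d, d.2, rfl⟩

theorem closure_image_mono {ι : Type*} (g : ι → G) {A B : Set ι} (h : A ⊆ B) :
    Subgroup.closure (g '' A) ≤ Subgroup.closure (g '' B) :=
  Subgroup.closure_mono (Set.image_mono h)

/-- The intersection condition for `g` over the subsets of `R`. -/
def InterCondOn {ι : Type*} (g : ι → G) (R : Set ι) : Prop :=
  ∀ I J : Set ι, I ⊆ R → J ⊆ R →
    Subgroup.closure (g '' I) ⊓ Subgroup.closure (g '' J) ≤ Subgroup.closure (g '' (I ∩ J))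

theorem InterCondOn.inf_le_of_inf_le {ι : Type*} {g : ι → G} {P Q I J : Set ι}
    (hP : InterCondOn g P) (hQ : InterCondOn g Q)
    (hPQ : Subgroup.closure (g '' P) ⊓ Subgroup.closure (g '' Q) ≤
      Subgroup.closure (g '' (P ∩ Q)))
    (hI : I ⊆ P) (hJ : J ⊆ Q) :
    Subgroup.closure (g '' I) ⊓ Subgroup.closure (g '' J) ≤
      Subgroup.closure (g '' (I ∩ J)) := by
  rintro x ⟨hxI, hxJ⟩
  have hx := hPQ ⟨closure_image_mono g hI hxI, closure_image_mono g hJ hxJ⟩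
  have h1 := hP I (P ∩ Q) hI Set.inter_subset_left ⟨hxI, hx⟩
  have h2 := hQ (I ∩ (P ∩ Q)) J (fun i hi => hi.2.2) hJ ⟨h1, hxJ⟩
  have hsub : I ∩ (P ∩ Q) ∩ J ⊆ I ∩ J := fun i hi => ⟨hi.1.1, hi.2⟩
  exact closure_image_mono g hsub h2

theorem exists_gap {n : ℕ} (hn : 2 ≤ n) {J : Set ℕ} (hJ : J ⊆ Set.Iic n) (hne : J ≠ Set.Iic n)
    (h1 : n - 1 ∈ J) (h2 : n ∈ J) :
    ∃ i ≤ n - 2, J = J ∩ Set.Iio i ∪ Set.Ioc i n := by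
  classical
  have hex : ∃ k, k ≤ n ∧ k ∉ J := by
    by_contra! h
    exact hne (hJ.antisymm h)
  obtain ⟨k, hk, hkJ⟩ := hex
  have hi := Nat.findGreatest_spec (P := fun m => m ∉ J) hk hkJ
  have hle := Nat.findGreatest_le (P := fun m => m ∉ J) n
  have hgt : ∀ m, Nat.findGreatest (fun m => m ∉ J) n < m → m ≤ n → m ∈ J := fun m hm hmn =>
    not_not.1 (Nat.findGreatest_is_greatest hm hmn)
  generalize Nat.findGreatest (fun m => m ∉ J) n = i at hi hle hgt
  have hi1 : i ≠ n - 1 := fun h => hi (h ▸ h1)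
  have hi2 : i ≠ n := fun h => hi (h ▸ h2)
  refine ⟨i, by omega, Set.ext fun m => ⟨fun hm => ?_, ?_⟩⟩
  · rcases lt_trichotomy m i with h | rfl | h
    · exact Or.inl ⟨hm, h⟩
    · exact absurd hm hi
    · exact Or.inr ⟨h, hJ hm⟩
  · rintro (h | h)
    · exact h.1
    · exact hgt m h.1 h.2

theorem InterCondOn.inf_le_of_gap {n i : ℕ} {g : ℕ → G} {R I J : Set ℕ}
    (hR : InterCondOn g R)
    (hcomm : ∀ a < i, ∀ b, i < b → b ≤ n → Commute (g a) (g b))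
    (hiR : Set.Iio i ⊆ R)
    (hinter : Subgroup.closure (g '' Set.Ioc i n) ⊓ Subgroup.closure (g '' R) ≤
      Subgroup.closure (g '' (Set.Ioc i n ∩ R)))
    (hI : I ⊆ R) (hJ : J = J ∩ Set.Iio i ∪ Set.Ioc i n) :
    Subgroup.closure (g '' I) ⊓ Subgroup.closure (g '' J) ≤
      Subgroup.closure (g '' (I ∩ J)) := by
  rintro x ⟨hxI, hxJ⟩
  have hxJ' : x ∈ Subgroup.closure (g '' J) := hxJ
  rw [hJ] at hxJ'
  obtain ⟨c, hc, d, hd, rfl⟩ := exists_mul_of_mem_closure_image_of_commute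
    (fun a ha b hb => hcomm a ha.2 b hb.1 hb.2) hxJ'
  have hcR := closure_image_mono g (Set.inter_subset_right.trans hiR) hc
  have hdR := (Subgroup.mul_mem_cancel_left _ hcR).1 (closure_image_mono g hI hxI)
  have hd' := hinter ⟨hd, hdR⟩
  have hsub : Set.Ioc i n ⊆ J := hJ ▸ Set.subset_union_right
  have hx : c * d ∈ Subgroup.closure (g '' (J ∩ R)) :=
    mul_mem (closure_image_mono g (Set.inter_subset_inter_right J hiR) hc)
      (closure_image_mono g (Set.inter_subset_inter_left R hsub) hd')
  exact closure_image_mono g (Set.inter_subset_inter_right I Set.inter_subset_left)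
    (hR I (J ∩ R) hI Set.inter_subset_right ⟨hxI, hx⟩)

/-- The intersection condition on `Set.Iic n` follows from that on `Set.Iic n \ {n}` and on
`Set.Iic n \ {n - 1}`. -/
theorem InterCondOn.Iic_of_facets {n : ℕ} (hn : 2 ≤ n) {g : ℕ → G}
    (hcomm : ∀ i ≤ n - 2, ∀ a < i, ∀ b, i < b → b ≤ n → Commute (g a) (g b))
    {P Q : Set ℕ} (hP : P = Set.Iio n) (hQ : Q = {j | j ≤ n ∧ j ≠ n - 1})
    (hgP : InterCondOn g P) (hgQ : InterCondOn g Q)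
    (hPQ : Subgroup.closure (g '' P) ⊓ Subgroup.closure (g '' Q) ≤
      Subgroup.closure (g '' (P ∩ Q)))
    (hiP : ∀ i ≤ n - 2, Subgroup.closure (g '' Set.Ioc i n) ⊓ Subgroup.closure (g '' P) ≤
      Subgroup.closure (g '' (Set.Ioc i n ∩ P)))
    (hiQ : ∀ i ≤ n - 2, Subgroup.closure (g '' Set.Ioc i n) ⊓ Subgroup.closure (g '' Q) ≤
      Subgroup.closure (g '' (Set.Ioc i n ∩ Q))) :
    InterCondOn g (Set.Iic n) := by
  have hcover : ∀ I ⊆ Set.Iic n, I ≠ Set.Iic n →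
      I ⊆ P ∨ I ⊆ Q ∨ ∃ i ≤ n - 2, I = I ∩ Set.Iio i ∪ Set.Ioc i n := by
    intro I hI hne
    by_cases h2 : n ∈ I
    · by_cases h1 : n - 1 ∈ I
      · exact Or.inr (Or.inr (exists_gap hn hI hne h1 h2))
      · refine Or.inr (Or.inl fun m hm => ?_)
        rw [hQ]
        exact ⟨hI hm, fun h => h1 (h ▸ hm)⟩
    · refine Or.inl fun m hm => ?_
      rw [hP]
      exact lt_of_le_of_ne (Set.mem_Iic.1 (hI hm)) fun h : m = n => h2 (h ▸ hm)
  have hltP : ∀ i ≤ n - 2, Set.Iio i ⊆ P := by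
    rintro i hi m (hm : m < i)
    rw [hP]
    exact show m < n by omega
  have hltQ : ∀ i ≤ n - 2, Set.Iio i ⊆ Q := by
    rintro i hi m (hm : m < i)
    rw [hQ]
    exact ⟨by omega, by omega⟩
  have hgapP : ∀ I J : Set ℕ, I ⊆ P → ∀ i ≤ n - 2, J = J ∩ Set.Iio i ∪ Set.Ioc i n →
      Subgroup.closure (g '' I) ⊓ Subgroup.closure (g '' J) ≤
        Subgroup.closure (g '' (I ∩ J)) := fun I J hI i hi hJ =>
    hgP.inf_le_of_gap (hcomm i hi) (hltP i hi) (hiP i hi) hI hJ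
  have hgapQ : ∀ I J : Set ℕ, I ⊆ Q → ∀ i ≤ n - 2, J = J ∩ Set.Iio i ∪ Set.Ioc i n →
      Subgroup.closure (g '' I) ⊓ Subgroup.closure (g '' J) ≤
        Subgroup.closure (g '' (I ∩ J)) := fun I J hI i hi hJ =>
    hgQ.inf_le_of_gap (hcomm i hi) (hltQ i hi) (hiQ i hi) hI hJ
  have hgap : ∀ I J : Set ℕ, ∀ i ≤ n - 2, ∀ j ≤ n - 2, i ≤ j →
      I = I ∩ Set.Iio i ∪ Set.Ioc i n → J = J ∩ Set.Iio j ∪ Set.Ioc j n →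
      Subgroup.closure (g '' I) ⊓ Subgroup.closure (g '' J) ≤
        Subgroup.closure (g '' (I ∩ J)) := by
    rintro I J i hi j hj hij hI hJ x ⟨hxI, hxJ⟩
    rw [SetLike.mem_coe, hJ] at hxJ
    obtain ⟨c, hc, d, hd, rfl⟩ := exists_mul_of_mem_closure_image_of_commute
      (fun a ha b hb => hcomm j hj a ha.2 b hb.1 hb.2) hxJ
    have hsubI : Set.Ioc j n ⊆ I := by
      rw [hI]
      exact fun m hm => Or.inr ⟨hij.trans_lt hm.1, hm.2⟩
    have hsubJ : Set.Ioc j n ⊆ J := hJ ▸ Set.subset_union_right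
    have hcI := (Subgroup.mul_mem_cancel_right _ (closure_image_mono g hsubI hd)).1 hxI
    have hcIJ := hgapP _ I (Set.inter_subset_right.trans (hltP j hj)) i hi hI ⟨hc, hcI⟩
    have hsub : J ∩ Set.Iio j ∩ I ⊆ I ∩ J := fun m hm => ⟨hm.2, hm.1.1⟩
    exact mul_mem (closure_image_mono g hsub hcIJ)
      (closure_image_mono g (Set.subset_inter hsubI hsubJ) hd)
  intro I J hI hJ
  by_cases hIn : I = Set.Iic n
  · rw [hIn, Set.inter_eq_self_of_subset_right hJ]
    exact inf_le_right
  by_cases hJn : J = Set.Iic n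
  · rw [hJn, Set.inter_eq_self_of_subset_left hI]
    exact inf_le_left
  rcases hcover I hI hIn with hI' | hI' | ⟨i, hi, hI'⟩ <;>
    rcases hcover J hJ hJn with hJ' | hJ' | ⟨j, hj, hJ'⟩
  · exact hgP I J hI' hJ'
  · exact hgP.inf_le_of_inf_le hgQ hPQ hI' hJ'
  · exact hgapP I J hI' j hj hJ'
  · rw [inf_comm, Set.inter_comm]
    exact hgP.inf_le_of_inf_le hgQ hPQ hJ' hI'
  · exact hgQ I J hI' hJ'
  · exact hgapQ I J hI' j hj hJ'
  · rw [inf_comm, Set.inter_comm]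
    exact hgapP J I hJ' i hi hI'
  · rw [inf_comm, Set.inter_comm]
    exact hgapQ J I hJ' i hi hI'
  · rcases le_total i j with hij | hij
    · exact hgap I J i hi j hj hij hI' hJ'
    · rw [inf_comm, Set.inter_comm]
      exact hgap J I j hj i hi hij hJ' hI'

theorem IsTailTriangleGroup.commute_ttGens {n : ℕ} {α : ℕ → G} {β : G}
    (h : IsTailTriangleGroup n α β) {i a b : ℕ} (hi : i ≤ n - 2) (ha : a < i) (hb : i < b) :
    Commute (ttGens n α β a) (ttGens n α β b) := by
  have := h.two_le
  simp only [ttGens]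
  rw [if_pos (show a < n by omega)]
  split_ifs with hbn
  · exact h.comm_αα a b (by omega) hbn
  · exact h.comm_αβ a (by omega)

theorem ttGens_image_eq {M : Type*} {n : ℕ} (α : ℕ → M) (β : M) {I : Set ℕ} (hI : I ⊆ Set.Iio n) :
    ttGens n α β '' I = α '' I :=
  Set.image_congr fun _ hi => if_pos (hI hi)

theorem interCondOn_ttGens_Iio {n : ℕ} {α : ℕ → G} (β : G) (h : stringInterCond n α) :
    InterCondOn (ttGens n α β) (Set.Iio n) := by
  intro I J hI hJ
  rw [ttGens_image_eq α β hI, ttGens_image_eq α β hJ,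
    ttGens_image_eq α β (Set.inter_subset_left.trans hI)]
  exact (h I J hI hJ).le

theorem interCondOn_ttGens_ne {n : ℕ} (hn : 2 ≤ n) {α : ℕ → G} {β : G}
    (h : stringInterCond n (fun i => if i = n - 1 then β else α i)) :
    InterCondOn (ttGens n α β) {j | j ≤ n ∧ j ≠ n - 1} := by
  have himage : ∀ I : Set ℕ, I ⊆ {j | j ≤ n ∧ j ≠ n - 1} → ttGens n α β '' I =
      (fun i => if i = n - 1 then β else α i) ''
        {i | i < n ∧ (if i = n - 1 then n else i) ∈ I} := by
    intro I hI
    ext x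
    constructor
    · rintro ⟨m, hm, rfl⟩
      obtain ⟨hmn, hm1⟩ := hI hm
      rcases hmn.lt_or_eq with hlt | rfl
      · exact ⟨m, ⟨hlt, by rwa [if_neg hm1]⟩, by simp [ttGens, hlt, hm1]⟩
      · exact ⟨m - 1, ⟨by omega, by rwa [if_pos rfl]⟩, by simp [ttGens]⟩
    · rintro ⟨m, ⟨hlt, hm⟩, rfl⟩
      refine ⟨_, hm, ?_⟩
      by_cases hm1 : m = n - 1
      · simp [ttGens, hm1]
      · simp [ttGens, hm1, hlt]
  intro I J hI hJ
  rw [himage I hI, himage J hJ, himage _ (Set.inter_subset_left.trans hI)]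
  refine (h _ _ (fun i hi => hi.1) (fun i hi => hi.1)).le.trans (closure_image_mono _ ?_)
  exact fun i hi => ⟨hi.1.1, hi.1.2, hi.2.2⟩

/-- Lemma 5.1 ("intersec"): for a tail-triangle group `Γ` with `n ≥ 2` whose subgroups
`Γ_n^1 = ⟨α_0,…,α_{n-1}⟩`, `Γ_n^2 = ⟨α_0,…,α_{n-2},β⟩` are string C-groups and whose
subgroup `Γ_0 = ⟨α_1,…,α_{n-1},β⟩` satisfies the intersection condition as a
tail-triangle group of rank `n`, the full intersection condition for `Γ` holds if and
only if `Γ_n^1 ∩ Γ_n^2 = ⟨α_0,…,α_{n-2}⟩` and, for `i = 0,…,n-2`,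
`Γ_i^+ ∩ Γ_n^1 = ⟨α_{i+1},…,α_{n-1}⟩` and `Γ_i^+ ∩ Γ_n^2 = ⟨α_{i+1},…,α_{n-2},β⟩`,
where `Γ_i^+ = ⟨α_{i+1},…,α_{n-1},β⟩`. -/
theorem interCond_iff_three_conditions
    (n : ℕ) (α : ℕ → G) (β : G)
    (htt : IsTailTriangleGroup n α β)
    (hP : IsStringCFamily n α)
    (hQ : IsStringCFamily n (fun i => if i = n - 1 then β else α i))
    (h0 : ttInterCond (n - 1) (fun i => α (i + 1)) β) :
    ttInterCond n α β ↔
      (Subgroup.closure (ttGens n α β '' Set.Iio n)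
          ⊓ Subgroup.closure (ttGens n α β '' {i | i ≤ n ∧ i ≠ n - 1})
        = Subgroup.closure (ttGens n α β '' Set.Iio (n - 1))) ∧
      ∀ i : ℕ, i ≤ n - 2 →
        (Subgroup.closure (ttGens n α β '' {j | i + 1 ≤ j ∧ j ≤ n})
            ⊓ Subgroup.closure (ttGens n α β '' Set.Iio n)
          = Subgroup.closure (ttGens n α β '' {j | i + 1 ≤ j ∧ j < n})) ∧
        (Subgroup.closure (ttGens n α β '' {j | i + 1 ≤ j ∧ j ≤ n})
            ⊓ Subgroup.closure (ttGens n α β '' {j | j ≤ n ∧ j ≠ n - 1})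
          = Subgroup.closure (ttGens n α β '' {j | i + 1 ≤ j ∧ j ≤ n ∧ j ≠ n - 1})) := by
  have hn := htt.two_le
  have hPQ : Set.Iio n ∩ {i | i ≤ n ∧ i ≠ n - 1} = Set.Iio (n - 1) := by
    ext m
    simp only [Set.mem_inter_iff, Set.mem_Iio, Set.mem_ofPred_eq]
    omega
  have hiP : ∀ i : ℕ, Set.Ioc i n ∩ Set.Iio n = {j | i + 1 ≤ j ∧ j < n} := by
    intro i
    ext m
    simp only [Set.mem_inter_iff, Set.mem_Iio, Set.mem_Ioc, Set.mem_ofPred_eq]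
    omega
  have hiQ : ∀ i : ℕ, Set.Ioc i n ∩ {j | j ≤ n ∧ j ≠ n - 1} =
      {j | i + 1 ≤ j ∧ j ≤ n ∧ j ≠ n - 1} := by
    intro i
    ext m
    simp only [Set.mem_inter_iff, Set.mem_Ioc, Set.mem_ofPred_eq]
    omega
  have hIoc : ∀ i : ℕ, {j | i + 1 ≤ j ∧ j ≤ n} = Set.Ioc i n := fun i => rfl
  simp only [hIoc, ← hPQ, ← hiP, ← hiQ]
  have hP' : Set.Iio n ⊆ Set.Iic n := Set.Iio_subset_Iic_self
  have hQ' : {j | j ≤ n ∧ j ≠ n - 1} ⊆ Set.Iic n := fun j hj => hj.1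
  have hI' : ∀ i, Set.Ioc i n ⊆ Set.Iic n := fun i j hj => hj.2
  constructor
  · exact fun h => ⟨h _ _ hP' hQ', fun i _ => ⟨h _ _ (hI' i) hP', h _ _ (hI' i) hQ'⟩⟩
  · rintro ⟨h1, h2⟩ I J hI hJ
    refine le_antisymm ?_ (le_inf (closure_image_mono _ Set.inter_subset_left)
      (closure_image_mono _ Set.inter_subset_right))
    exact InterCondOn.Iic_of_facets hn
      (fun i hi a ha b hb _ => htt.commute_ttGens hi ha hb) rfl rfl
      (interCondOn_ttGens_Iio β hP.inter) (interCondOn_ttGens_ne hn hQ.inter) h1.le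
      (fun i hi => (h2 i hi).1.le) (fun i hi => (h2 i hi).2.le) I J hI hJ
end TailTriangle
end

section
/- Let Γ(P) = ⟨α_0, …, α_{n−2}, α_{n−1}⟩ be a string C-group of rank n ≥ 2. Then there exist subsets T_{n−1} ⊆ T_{n−2} ⊆ ⋯ ⊆ T_1 ⊆ T_0 of Γ(P) with T_{n−1} = {1, α_{n−1}} such that, for each 0 ≤ j ≤ n−1, T_j is a right transversal of the subgroup ⟨α_j, …, α_{n−2}⟩ in the subgroup ⟨α_j, …, α_{n−2}, α_{n−1}⟩. In particular, T_0 is a right transversal of ⟨α_0, …, α_{n−2}⟩ in Γ(P) containing 1 that contains nested transversals for all the 'tail' subgroup pairs. -/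
namespace StringC

variable {G : Type*} [Group G]

/-- The intersection condition for a string generating family `ρ 0, …, ρ (n-1)`. -/
def stringInterCond (n : ℕ) (ρ : ℕ → G) : Prop :=
  ∀ I J : Set ℕ, I ⊆ Set.Iio n → J ⊆ Set.Iio n →
    Subgroup.closure (ρ '' I) ⊓ Subgroup.closure (ρ '' J)
      = Subgroup.closure (ρ '' (I ∩ J))

/-- A family of involutions with string diagram satisfying the intersection condition. -/
structure IsStringCFamily (n : ℕ) (ρ : ℕ → G) : Prop where
  orderOf_gen : ∀ i < n, orderOf (ρ i) = 2
  comm : ∀ i j : ℕ, i + 2 ≤ j → j < n → Commute (ρ i) (ρ j)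
  inter : stringInterCond n ρ

/-- `G` is a string C-group of rank `n` on the generators `ρ 0, …, ρ (n-1)`. -/
def IsStringCGroup (n : ℕ) (ρ : ℕ → G) : Prop :=
  IsStringCFamily n ρ ∧ Subgroup.closure (ρ '' Set.Iio n) = ⊤

/-- `T` is a right transversal of the subgroup `H` inside the subgroup `K`:
`T ⊆ K` and every right coset `H g` with `g ∈ K` contains exactly one element of `T`. -/
def IsRightTransversal (H K : Subgroup G) (T : Set G) : Prop :=
  T ⊆ (K : Set G) ∧ ∀ g ∈ K, ∃! t, t ∈ T ∧ g * t⁻¹ ∈ H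

/-- A right transversal of `H ⊓ L` in `L` extends to a right transversal of `H` in any
subgroup `K` containing `H` and `L`. -/
theorem IsRightTransversal.exists_superset {H K L : Subgroup G} (hHK : H ≤ K) (hLK : L ≤ K)
    {A : Set G} (hA : IsRightTransversal (H ⊓ L) L A) :
    ∃ B, A ⊆ B ∧ IsRightTransversal H K B := by
  let s := QuotientGroup.rightRel H
  let r : G → G := fun g => (Quotient.mk s g).out
  have hr : ∀ g, g * (r g)⁻¹ ∈ H := fun g =>
    QuotientGroup.rightRel_apply.1 (Quotient.mk_out (s := s) g)
  have hr_eq : ∀ g t, g * t⁻¹ ∈ H → r t = r g := fun g t hgt =>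
    congrArg Quotient.out (Quotient.sound (s := s) (QuotientGroup.rightRel_apply.2 hgt))
  have hmul : ∀ {a b c : G}, a * b⁻¹ ∈ H → a * c⁻¹ ∈ H → b * c⁻¹ ∈ H := by
    intro a b c hab hac
    have := H.mul_mem (H.inv_mem hab) hac
    simpa [mul_assoc] using this
  refine ⟨A ∪ {t | t ∈ K ∧ r t = t ∧ ∀ a ∈ A, t * a⁻¹ ∉ H}, Set.subset_union_left, ?_, ?_⟩
  · rintro t (ht | ht)
    · exact hLK (hA.1 ht)
    · exact ht.1
  · intro g hg
    by_cases hex : ∃ a ∈ A, g * a⁻¹ ∈ H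
    · obtain ⟨a, ha, hga⟩ := hex
      refine ⟨a, ⟨Or.inl ha, hga⟩, ?_⟩
      rintro t ⟨ht | ht, hgt⟩
      · have haL := hA.1 ha
        have htL := hA.1 ht
        exact (hA.2 a haL).unique
          ⟨ht, hmul hga hgt, L.mul_mem haL (L.inv_mem htL)⟩
          ⟨ha, by simp⟩
      · exact absurd (hmul hgt hga) (ht.2.2 a ha)
    · push Not at hex
      refine ⟨r g, ⟨Or.inr ⟨?_, hr_eq g (r g) (hr g), ?_⟩, hr g⟩, ?_⟩
      · have := K.mul_mem (K.inv_mem (hHK (hr g))) hg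
        simpa using this
      · intro a ha hra
        refine hex a ha ?_
        have := H.mul_mem (hr g) hra
        simpa [mul_assoc] using this
      · rintro t ⟨ht | ht, hgt⟩
        · exact absurd hgt (hex t ht)
        · rw [← ht.2.1, hr_eq g t hgt]

/-- If `a` has order two, then `{1, a}` is a right transversal of the trivial subgroup in `⟨a⟩`. -/
theorem isRightTransversal_bot_closure_singleton {a : G} (ha : orderOf a = 2) :
    IsRightTransversal ⊥ (Subgroup.closure {a}) {1, a} := by
  have hsq : a ^ 2 = 1 := ha ▸ pow_orderOf_eq_one a
  have hcl : (Subgroup.closure {a} : Set G) = {1, a} := by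
    ext x
    simp only [SetLike.mem_coe, Subgroup.mem_closure_singleton, Set.mem_insert_iff,
      Set.mem_singleton_iff]
    constructor
    · rintro ⟨k, rfl⟩
      rcases Int.even_or_odd' k with ⟨m, rfl | rfl⟩
      · left
        rw [zpow_mul]
        norm_cast
        simp [hsq]
      · right
        rw [zpow_add, zpow_mul]
        norm_cast
        simp [hsq]
    · rintro (rfl | rfl)
      · exact ⟨0, zpow_zero a⟩
      · exact ⟨1, zpow_one x⟩
  refine ⟨hcl.ge, fun g hg => ⟨g, ⟨hcl.le hg, by simp⟩, ?_⟩⟩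
  rintro t ⟨-, ht⟩
  exact (mul_inv_eq_one.1 (Subgroup.mem_bot.1 ht)).symm

/-- Lemma `utrans` (for one factor): a string C-group `Γ(P) = ⟨α 0, …, α (n-1)⟩` admits
nested right transversals `T (n-1) ⊆ ⋯ ⊆ T 1 ⊆ T 0`, with `T (n-1) = {1, α (n-1)}`, where
`T j` is a right transversal of `⟨α j, …, α (n-2)⟩` in `⟨α j, …, α (n-1)⟩`; in particular
`T 0` is a right transversal of `⟨α 0, …, α (n-2)⟩` in `Γ(P)` containing `1`. -/
theorem nested_transversals
    (n : ℕ) (α : ℕ → G) (h2 : 2 ≤ n) (h : IsStringCGroup n α) :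
    ∃ T : ℕ → Set G,
      T (n - 1) = {1, α (n - 1)} ∧
      (∀ j : ℕ, j + 1 ≤ n - 1 → T (j + 1) ⊆ T j) ∧
      (1 : G) ∈ T 0 ∧
      ∀ j < n,
        IsRightTransversal
          (Subgroup.closure (α '' {i | j ≤ i ∧ i < n - 1}))
          (Subgroup.closure (α '' {i | j ≤ i ∧ i < n}))
          (T j) := by
  obtain ⟨hC, -⟩ := h
  let H : ℕ → Subgroup G := fun j => Subgroup.closure (α '' {i | j ≤ i ∧ i < n - 1})
  let K : ℕ → Subgroup G := fun j => Subgroup.closure (α '' {i | j ≤ i ∧ i < n})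
  have hHK : ∀ j, H j ≤ K j := fun j =>
    Subgroup.closure_mono (Set.image_mono fun i hi => ⟨hi.1, by have := hi.2; omega⟩)
  have hKK : ∀ j, K (j + 1) ≤ K j := fun j =>
    Subgroup.closure_mono (Set.image_mono fun i hi => ⟨by have := hi.1; omega, hi.2⟩)
  have hinf : ∀ j, H j ⊓ K (j + 1) = H (j + 1) := by
    intro j
    refine (hC.inter _ _ (fun i hi => ?_) (fun i hi => hi.2)).trans ?_
    · have := hi.2
      simp only [Set.mem_Iio]
      omega
    · congr 2
      ext i
      simp only [Set.mem_inter_iff, Set.mem_ofPred_eq]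
      omega
  have hstep : ∀ (j : ℕ) (A : Set G), ∃ B, A ⊆ B ∧
      (IsRightTransversal (H (j + 1)) (K (j + 1)) A → IsRightTransversal (H j) (K j) B) := by
    intro j A
    by_cases hA : IsRightTransversal (H (j + 1)) (K (j + 1)) A
    · rw [← hinf] at hA
      obtain ⟨B, hAB, hB⟩ := hA.exists_superset (hHK j) (hKK j)
      exact ⟨B, hAB, fun _ => hB⟩
    · exact ⟨A, subset_rfl, fun h => absurd h hA⟩
  choose F hF hFT using hstep
  let S : ℕ → Set G := fun k =>
    Nat.rec {1, α (n - 1)} (fun k A => F (n - 1 - (k + 1)) A) k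
  have hS : ∀ k, S k ⊆ S (k + 1) := fun k => hF _ _
  have hbase : IsRightTransversal (H (n - 1)) (K (n - 1)) {1, α (n - 1)} := by
    have hH : H (n - 1) = ⊥ := by
      have : {i | n - 1 ≤ i ∧ i < n - 1} = (∅ : Set ℕ) := by
        ext i
        simp
      simp only [H, this, Set.image_empty, Subgroup.closure_empty]
    have hK : K (n - 1) = Subgroup.closure {α (n - 1)} := by
      have : {i | n - 1 ≤ i ∧ i < n} = ({n - 1} : Set ℕ) := by
        ext i
        simp only [Set.mem_ofPred_eq, Set.mem_singleton_iff]
        omega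
      simp only [K, this, Set.image_singleton]
    rw [hH, hK]
    exact isRightTransversal_bot_closure_singleton (hC.orderOf_gen _ (by omega))
  have hST : ∀ k, k < n → IsRightTransversal (H (n - 1 - k)) (K (n - 1 - k)) (S k) := by
    intro k
    induction k with
    | zero => exact fun _ => hbase
    | succ k ih =>
      intro hk
      apply hFT (n - 1 - (k + 1))
      rw [show n - 1 - (k + 1) + 1 = n - 1 - k by omega]
      exact ih (by omega)
  refine ⟨fun j => S (n - 1 - j), ?_, fun j hj => ?_, ?_, fun j hj => ?_⟩
  · simp only [Nat.sub_self]
    rfl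
  · have := hS (n - 1 - (j + 1))
    rwa [show n - 1 - (j + 1) + 1 = n - 1 - j by omega] at this
  · exact monotone_nat_of_le_succ hS (Nat.zero_le _) (Set.mem_insert _ _)
  · have := hST (n - 1 - j) (by omega)
    rwa [show n - 1 - (n - 1 - j) = j by omega] at this

end StringC
end

section
/- Let Π = Γ(P) *_{Γ(K)} Γ(Q) be the amalgamated free product of string C-groups Γ(P) and Γ(Q) along their common facet subgroup Γ(K), with Γ(P) and Γ(Q) identified with their images in Π. For 0 ≤ j ≤ n−1, let A_j = ⟨α_j,…,α_{n−2},α_{n−1}⟩ ≤ Γ(P), B_j = ⟨α_j,…,α_{n−2},β_{n−1}⟩ ≤ Γ(Q), and C_j = ⟨α_j,…,α_{n−2}⟩ ≤ Γ(K). Then the natural homomorphism from the amalgamated free product A_j *_{C_j} B_j to Π (induced by the inclusions of A_j and B_j into Π, which agree on C_j) is injective, and its image is the subgroup ⟨α_j, …, α_{n−2}, α_{n−1}, β_{n−1}⟩ of Π. -/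
/-!
The amalgamated free product `Π = Γ(P) *_{Γ(K)} Γ(Q)` of two string C-groups of rank
`n ≥ 2` along their common facet subgroup `Γ(K) = ⟨α 0, …, α (n-2)⟩`.  We work inside the
group `Π`, in which `Γ(P) = ⟨α 0, …, α (n-1)⟩` and `Γ(Q) = ⟨α 0, …, α (n-2), β⟩` are
identified with their images; being an amalgam is expressed by the pushout universal
property together with the fact that `Γ(P)` and `Γ(Q)` generate `Π`.
-/

universe u

namespace Amalgam

variable {G : Type u} [Group G]

/-- The generating family of `Γ(Q)`: `qgen n α β i = α i` for `i ≠ n-1`, and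
`qgen n α β (n-1) = β`. -/
def qgen (n : ℕ) (α : ℕ → G) (β : G) : ℕ → G := fun i => if i = n - 1 then β else α i

/-- The intersection condition for a string generating family `ρ 0, …, ρ (n-1)`. -/
def stringInterCond (n : ℕ) (ρ : ℕ → G) : Prop :=
  ∀ I J : Set ℕ, I ⊆ Set.Iio n → J ⊆ Set.Iio n →
    Subgroup.closure (ρ '' I) ⊓ Subgroup.closure (ρ '' J)
      = Subgroup.closure (ρ '' (I ∩ J))

/-- A family of involutions with string diagram satisfying the intersection condition
(the subgroup it generates is then a string C-group on these generators). -/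
structure IsStringCFamily (n : ℕ) (ρ : ℕ → G) : Prop where
  orderOf_gen : ∀ i < n, orderOf (ρ i) = 2
  comm : ∀ i j : ℕ, i + 2 ≤ j → j < n → Commute (ρ i) (ρ j)
  inter : stringInterCond n ρ

/-- `G` (with subgroups `P`, `Q`, `K`, `K ≤ P`, `K ≤ Q`) is the free product of `P` and
`Q` amalgamated along `K`: `P` and `Q` generate `Π`, and every pair of homomorphisms on
`P` and `Q` agreeing on `K` extends to a homomorphism on `Π` (the pushout property; the
extension is automatically unique since `P ⊔ Q = ⊤`). -/
def IsAmalgam (P Q K : Subgroup G) : Prop :=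
  K ≤ P ∧ K ≤ Q ∧ P ⊔ Q = ⊤ ∧
  ∀ (H : Type u) [Group H] (f : P →* H) (g : Q →* H),
    (∀ (x : G) (hxP : x ∈ P) (hxQ : x ∈ Q), x ∈ K → f ⟨x, hxP⟩ = g ⟨x, hxQ⟩) →
    ∃ F : G →* H, (∀ x : P, F x = f ⟨x, x.2⟩) ∧ (∀ x : Q, F x = g ⟨x, x.2⟩)

/-- `Γ(P) = ⟨α 0, …, α (n-1)⟩`. -/
def ΓP (n : ℕ) (α : ℕ → G) : Subgroup G := Subgroup.closure (α '' Set.Iio n)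

/-- `Γ(Q) = ⟨α 0, …, α (n-2), β⟩`. -/
def ΓQ (n : ℕ) (α : ℕ → G) (β : G) : Subgroup G :=
  Subgroup.closure (qgen n α β '' Set.Iio n)

/-- `Γ(K) = ⟨α 0, …, α (n-2)⟩`. -/
def ΓK (n : ℕ) (α : ℕ → G) : Subgroup G := Subgroup.closure (α '' Set.Iio (n - 1))

end Amalgam

namespace Monoid.PushoutI

variable {ι : Type*} {G G' : ι → Type*} {H H' : Type*}
  [∀ i, Group (G i)] [∀ i, Group (G' i)] [Group H] [Group H']
  {φ : ∀ i, H →* G i} {φ' : ∀ i, H' →* G' i}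

/-- The underlying word of a normal word has no letter in the base group. -/
theorem NormalWord.reduced {d : NormalWord.Transversal φ} (w : NormalWord d) :
    Reduced φ w.toWord := by
  rintro ⟨i, g⟩ hg hr
  have h1 := ((d.compl i).equiv_snd_eq_self_iff_mem (one_mem _)).2 (w.normalized i g hg)
  have h2 := ((d.compl i).coe_equiv_snd_eq_one_iff_mem (d.one_mem i)).2 hr
  exact w.ne_one _ hg (h1.symm.trans h2)

/-- A morphism of diagrams of groups whose legs are injective induces an injective map of pushouts,
provided it pulls the amalgamated subgroups of the target back to those of the source. -/
theorem injective_of_range_comap_le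
    (hφ : ∀ i, Function.Injective (φ i)) (hφ' : ∀ i, Function.Injective (φ' i))
    (f : ∀ i, G i →* G' i) (ψ : H →* H')
    (hf : ∀ i, Function.Injective (f i)) (hψ : Function.Injective ψ)
    (hrange : ∀ i, (φ' i).range.comap (f i) ≤ (φ i).range)
    (F : PushoutI φ →* PushoutI φ') (hFof : ∀ i g, F (of i g) = of i (f i g))
    (hFbase : ∀ h, F (base φ h) = base φ' (ψ h)) :
    Function.Injective F := by
  classical
  obtain ⟨d⟩ := NormalWord.transversal_nonempty φ hφ
  rw [injective_iff_map_eq_one]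
  intro x hx
  obtain ⟨w, rfl⟩ := (NormalWord.equiv (d := d)).symm.surjective x
  change F w.prod = 1 at hx
  change w.prod = 1
  let w' : CoprodI.Word G' :=
    { toList := w.toList.map fun l => ⟨l.1, f l.1 l.2⟩
      ne_one := by
        simp only [List.mem_map, forall_exists_index, and_imp, forall_apply_eq_imp_iff₂]
        exact fun l hl => (map_ne_one_iff (f l.1) (hf l.1)).2 (w.ne_one l hl)
      chain_ne := (List.isChain_map _).2 w.chain_ne }
  have hw' : Reduced φ' w' := by
    simp only [Reduced, w', List.mem_map, forall_exists_index, and_imp, forall_apply_eq_imp_iff₂]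
    exact fun l hl h => w.reduced l hl (hrange l.1 h)
  have hprod : F (ofCoprodI w.toWord.prod) = ofCoprodI w'.prod := by
    simp [CoprodI.Word.prod, w', map_list_prod, Function.comp_def, hFof]
  have hFw : base φ' (ψ w.head) * ofCoprodI w'.prod = 1 := by
    rw [← hx, NormalWord.prod, map_mul, hFbase, hprod]
  have hempty : w' = .empty := hw'.eq_empty_of_mem_range hφ' <| by
    rw [← inv_eq_of_mul_eq_one_right hFw]
    exact inv_mem ⟨_, rfl⟩
  have hlist : w.toList = [] := List.map_eq_nil_iff.1 (congrArg CoprodI.Word.toList hempty)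
  have hhead : w.head = 1 := by
    rw [hempty, CoprodI.Word.prod_empty, map_one, mul_one] at hFw
    exact (map_eq_one_iff ψ hψ).1 ((map_eq_one_iff _ (base_injective hφ')).1 hFw)
  simp [NormalWord.prod, CoprodI.Word.prod, hlist, hhead]

end Monoid.PushoutI

namespace Amalgam

variable {G : Type u} [Group G]

open Monoid in
/-- In the free product of `P` and `Q` amalgamated along `K`, subgroups `A ≤ P` and `B ≤ Q` that
meet `K` in the same subgroup `C` generate their free product amalgamated along `C`. -/
theorem IsAmalgam.subgroupOf {P Q K A B C D : Subgroup G} (h : IsAmalgam P Q K)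
    (hAP : A ≤ P) (hBQ : B ≤ Q) (hA : A ⊓ K = C) (hB : B ⊓ K = C) (hD : A ⊔ B = D) :
    IsAmalgam (A.subgroupOf D) (B.subgroupOf D) (C.subgroupOf D) := by
  obtain ⟨hKP, hKQ, -, hlift⟩ := h
  have hCA : C ≤ A := hA ▸ inf_le_left
  have hCB : C ≤ B := hB ▸ inf_le_left
  have hCK : C ≤ K := hA ▸ inf_le_right
  have hAD : A ≤ D := hD ▸ le_sup_left
  have hBD : B ≤ D := hD ▸ le_sup_right
  refine ⟨Subgroup.comap_mono hCA, Subgroup.comap_mono hCB, ?_, fun H _ f g hfg => ?_⟩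
  · rw [← Subgroup.subgroupOf_sup hAD hBD, hD, Subgroup.subgroupOf_self]
  let S : Bool → Subgroup G := fun b => cond b A B
  let T : Bool → Subgroup G := fun b => cond b P Q
  have hCS : ∀ b, C ≤ S b := Bool.forall_bool.2 ⟨hCB, hCA⟩
  have hKT : ∀ b, K ≤ T b := Bool.forall_bool.2 ⟨hKQ, hKP⟩
  have hST : ∀ b, S b ≤ T b := Bool.forall_bool.2 ⟨hBQ, hAP⟩
  have hSK : ∀ b, S b ⊓ K ≤ C := Bool.forall_bool.2 ⟨hB.le, hA.le⟩
  let φ : ∀ b, C →* S b := fun b => Subgroup.inclusion (hCS b)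
  let φ' : ∀ b, K →* T b := fun b => Subgroup.inclusion (hKT b)
  let θ : PushoutI φ →* G := PushoutI.lift (fun b => (S b).subtype) C.subtype fun _ => rfl
  have hθof : ∀ b (x : S b), θ (PushoutI.of b x) = x := fun _ _ => PushoutI.lift_of ..
  obtain ⟨F, hFP, hFQ⟩ := hlift (PushoutI φ') (PushoutI.of (φ := φ') true)
    (PushoutI.of (φ := φ') false) fun x _ _ hx =>
      (PushoutI.of_apply_eq_base φ' true ⟨x, hx⟩).trans
        (PushoutI.of_apply_eq_base φ' false ⟨x, hx⟩).symm
  have hF : ∀ b (x : T b), F x = PushoutI.of (φ := φ') b x := Bool.forall_bool.2 ⟨hFQ, hFP⟩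
  have hθ : Function.Injective θ := by
    refine Function.Injective.of_comp (f := F) ?_
    refine PushoutI.injective_of_range_comap_le
      (fun b => Subgroup.inclusion_injective (hCS b))
      (fun b => Subgroup.inclusion_injective (hKT b))
      (fun b => Subgroup.inclusion (hST b)) (Subgroup.inclusion hCK)
      (fun b => Subgroup.inclusion_injective (hST b)) (Subgroup.inclusion_injective hCK)
      ?_ (F.comp θ) ?_ ?_
    · rintro b ⟨x, hx⟩ ⟨k, hk⟩
      have hxk : (k : G) = x := congrArg Subtype.val hk
      exact ⟨⟨x, hSK b ⟨hx, hxk ▸ k.2⟩⟩, rfl⟩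
    · intro b x
      exact (congrArg F (hθof b x)).trans (hF b (Subgroup.inclusion (hST b) x))
    · intro x
      exact (congrArg F (PushoutI.lift_base ..)).trans <|
        (hF true ⟨x, hKT true (hCK x.2)⟩).trans <|
          PushoutI.of_apply_eq_base φ' true (Subgroup.inclusion hCK x)
  have hDθ : D ≤ θ.range := by
    rw [← hD]
    exact sup_le (fun x hx => ⟨PushoutI.of (φ := φ) true ⟨x, hx⟩, hθof true ⟨x, hx⟩⟩)
      (fun x hx => ⟨PushoutI.of (φ := φ) false ⟨x, hx⟩, hθof false ⟨x, hx⟩⟩)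
  let fg : ∀ b, S b →* H := fun b => match b with
    | true => f.comp (Subgroup.subgroupOfEquivOfLe hAD).symm.toMonoidHom
    | false => g.comp (Subgroup.subgroupOfEquivOfLe hBD).symm.toMonoidHom
  have hfgC : ∀ b, (fg b).comp (φ b) = (fg true).comp (φ true) := Bool.forall_bool.2
    ⟨MonoidHom.ext fun x => (hfg ⟨x, hAD (hCA x.2)⟩ (hCA x.2) (hCB x.2) x.2).symm, rfl⟩
  let L : PushoutI φ →* H := PushoutI.lift fg _ hfgC
  let E : D →* PushoutI φ :=
    (MonoidHom.ofInjective hθ).symm.toMonoidHom.comp (Subgroup.inclusion hDθ)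
  have hE : ∀ b (x : S b) (hx : (x : G) ∈ D), E ⟨x, hx⟩ = PushoutI.of (φ := φ) b x := by
    intro b x hx
    apply hθ
    exact (MonoidHom.apply_ofInjective_symm hθ _).trans (hθof b x).symm
  refine ⟨L.comp E, fun x => ?_, fun x => ?_⟩
  · exact (congrArg L (hE true ⟨x.1, x.2⟩ x.1.2)).trans (PushoutI.lift_of ..)
  · exact (congrArg L (hE false ⟨x.1, x.2⟩ x.1.2)).trans (PushoutI.lift_of ..)

/-- Below the last index, `qgen n α β` agrees with `α`. -/
theorem qgen_image_of_subset_Iio {X : Type*} {n : ℕ} {α : ℕ → X} {β : X} {I : Set ℕ}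
    (hI : I ⊆ Set.Iio (n - 1)) : qgen n α β '' I = α '' I :=
  Set.image_congr fun _ hi => if_neg (hI hi).ne

/-- Lemma `amalj`: in the amalgam `Π = Γ(P) *_{Γ(K)} Γ(Q)` of string C-groups of rank
`n ≥ 2`, for each `0 ≤ j ≤ n-1` the subgroup `D_j = ⟨α j, …, α (n-1), β⟩` is itself the
amalgamated free product `A_j *_{C_j} B_j` of `A_j = ⟨α j, …, α (n-1)⟩` and
`B_j = ⟨α j, …, α (n-2), β⟩` along `C_j = ⟨α j, …, α (n-2)⟩`; that is, the natural
homomorphism `A_j *_{C_j} B_j → Π` is injective with image `⟨α j, …, α (n-1), β⟩`. -/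
theorem subgroup_amalgam
    (n : ℕ) (α : ℕ → G) (β : G) (h2 : 2 ≤ n)
    (hP : IsStringCFamily n α) (hQ : IsStringCFamily n (qgen n α β))
    (hAm : IsAmalgam (ΓP n α) (ΓQ n α β) (ΓK n α)) :
    ∀ j < n,
      IsAmalgam
        ((Subgroup.closure (α '' {i | j ≤ i ∧ i < n})).subgroupOf
          (Subgroup.closure (α '' {i | j ≤ i ∧ i < n} ∪ qgen n α β '' {i | j ≤ i ∧ i < n})))
        ((Subgroup.closure (qgen n α β '' {i | j ≤ i ∧ i < n})).subgroupOf
          (Subgroup.closure (α '' {i | j ≤ i ∧ i < n} ∪ qgen n α β '' {i | j ≤ i ∧ i < n})))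
        ((Subgroup.closure (α '' {i | j ≤ i ∧ i < n - 1})).subgroupOf
          (Subgroup.closure (α '' {i | j ≤ i ∧ i < n} ∪ qgen n α β '' {i | j ≤ i ∧ i < n}))) := by
  intro j _
  have hI : {i | j ≤ i ∧ i < n} ⊆ Set.Iio n := fun _ hi => hi.2
  have hJ : Set.Iio (n - 1) ⊆ Set.Iio n := Set.Iio_subset_Iio (Nat.sub_le n 1)
  have hIJ : {i | j ≤ i ∧ i < n} ∩ Set.Iio (n - 1) = {i | j ≤ i ∧ i < n - 1} := by
    ext i
    simp only [Set.mem_inter_iff, Set.mem_ofPred_eq, Set.mem_Iio]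
    lia
  refine hAm.subgroupOf (Subgroup.closure_mono (Set.image_mono hI))
    (Subgroup.closure_mono (Set.image_mono hI)) ?_ ?_ (Subgroup.closure_union ..).symm
  · rw [ΓK, hP.inter _ _ hI hJ, hIJ]
  · rw [ΓK, ← qgen_image_of_subset_Iio (β := β) subset_rfl, hQ.inter _ _ hI hJ, hIJ,
      qgen_image_of_subset_Iio fun _ hi => hi.2]

end Amalgam
end

section
/- Let Π = Γ(P) *_{Γ(K)} Γ(Q) as below, and let T_P, T_Q be right transversals of Γ(K) in Γ(P) and Γ(Q) respectively, containing nested transversals T_{P,j}, T_{Q,j} (0 ≤ j ≤ n−1) as in the nested-transversal lemma: T_{P,j} ⊆ T_P is a right transversal of ⟨α_j,…,α_{n−2}⟩ in ⟨α_j,…,α_{n−2},α_{n−1}⟩ and T_{Q,j} ⊆ T_Q is a right transversal of ⟨α_j,…,α_{n−2}⟩ in ⟨α_j,…,α_{n−2},β_{n−1}⟩, with T_{P,n−1} = {1,α_{n−1}}, T_{Q,n−1} = {1,β_{n−1}}, T_{P,0} = T_P, T_{Q,0} = T_Q. Let −1 ≤ j ≤ n−2 and let μ be an element of the subgroup Π_j^+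 := ⟨α_{j+1},…,α_{n−2},α_{n−1},β_{n−1}⟩ of Π with reduced decomposition μ = κτ_1⋯τ_m relative to T_P, T_Q. Then κ ∈ ⟨α_{j+1},…,α_{n−2}⟩ and τ_i ∈ T_{P,j+1} ∪ T_{Q,j+1} for i = 1,…,m. -/
/-!
The amalgamated free product `Π = Γ(P) *_{Γ(K)} Γ(Q)` of two string C-groups of rank
`n ≥ 2` along their common facet subgroup `Γ(K) = ⟨α 0, …, α (n-2)⟩`.  We work inside the
group `Π`, in which `Γ(P) = ⟨α 0, …, α (n-1)⟩` and `Γ(Q) = ⟨α 0, …, α (n-2), β⟩` are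
identified with their images; being an amalgam is expressed by the pushout universal
property together with the fact that `Γ(P)` and `Γ(Q)` generate `Π`.
-/

universe u

namespace Amalgam

variable {G : Type u} [Group G]

/-- `T` is a right transversal of the subgroup `H` inside the subgroup `K`:
`T ⊆ K` and every right coset `H g` with `g ∈ K` contains exactly one element of `T`. -/
def IsRightTransversal (H K : Subgroup G) (T : Set G) : Prop :=
  T ⊆ (K : Set G) ∧ ∀ g ∈ K, ∃! t, t ∈ T ∧ g * t⁻¹ ∈ H

/-- `μ = κ * τ 0 * ⋯ * τ (m-1)` is a reduced decomposition relative to the transversals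
`TP`, `TQ` of `K` (the amalgamated subgroup): the leading element `κ` lies in `K`, every
transversal element `τ i` is a nonidentity element of `TP` or `TQ`, and consecutive
transversal elements come from different transversals. -/
def IsReducedDecomp (K : Subgroup G) (TP TQ : Set G)
    (μ κ : G) (m : ℕ) (τ : Fin m → G) : Prop :=
  κ ∈ K ∧ μ = κ * (List.ofFn τ).prod ∧
  ∃ side : Fin m → Bool,
    (∀ i : Fin m, τ i ≠ 1 ∧ τ i ∈ (if side i then TP else TQ)) ∧
    ∀ (i : ℕ) (h1 : i + 1 < m), side ⟨i, by omega⟩ ≠ side ⟨i + 1, h1⟩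

/-- A list of letters, each a nonidentity element of the set with the same index, in which
adjacent letters have different indices. -/
def IsReducedList {ι : Type*} (T : ι → Set G) (L : List (ι × G)) : Prop :=
  (∀ x ∈ L, x.2 ≠ 1 ∧ x.2 ∈ T x.1) ∧ L.IsChain fun x y => x.1 ≠ y.1

theorem IsRightTransversal.exists_mul {H K : Subgroup G} {T : Set G}
    (hT : IsRightTransversal H K T) {g : G} (hg : g ∈ K) :
    ∃ h ∈ H, ∃ t ∈ T, g = h * t := by
  obtain ⟨t, ⟨ht, hm⟩, -⟩ := hT.2 g hg
  exact ⟨_, hm, t, ht, by group⟩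

theorem IsRightTransversal.isComplement {H K : Subgroup G} {T : Set G} (hHK : H ≤ K)
    (hT : IsRightTransversal H K T) :
    Subgroup.IsComplement ((Subgroup.inclusion hHK).range : Set K)
      (Subtype.val ⁻¹' T : Set K) := by
  rw [Subgroup.isComplement_iff_existsUnique_mul_inv_mem]
  intro g
  have hmem : ∀ x : K, x ∈ (Subgroup.inclusion hHK).range ↔ (x : G) ∈ H := by
    intro x
    rw [Subgroup.inclusion_range, Subgroup.mem_subgroupOf]
  obtain ⟨t, ⟨ht, hm⟩, hu⟩ := hT.2 g g.2
  refine ⟨⟨⟨t, hT.1 ht⟩, ht⟩, (hmem _).2 hm, ?_⟩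
  rintro ⟨⟨s, hsK⟩, hs⟩ hsm
  have := hu s ⟨hs, (hmem _).1 hsm⟩
  subst this
  rfl

section Uniqueness

variable {ι : Type*} {K : Subgroup G} {A : ι → Subgroup G} {T : ι → Set G}

/-- If the inclusions of the subgroups `A i` into their abstract amalgam over `K` extend to
`G`, then decompositions with respect to right transversals of `K` in the `A i` are unique. -/
theorem IsReducedList.unique (hKA : ∀ i, K ≤ A i)
    (hT : ∀ i, IsRightTransversal K (A i) (T i)) (h1 : ∀ i, (1 : G) ∈ T i) [Nonempty ι]
    (F : G →* Monoid.PushoutI fun i => Subgroup.inclusion (hKA i))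
    (hF : ∀ i (x : A i), F x = Monoid.PushoutI.of i x)
    {κ κ' : G} (hκ : κ ∈ K) (hκ' : κ' ∈ K) {L L' : List (ι × G)}
    (hL : IsReducedList T L) (hL' : IsReducedList T L')
    (h : κ * (L.map Prod.snd).prod = κ' * (L'.map Prod.snd).prod) :
    κ = κ' ∧ L = L' := by
  let d : Monoid.PushoutI.NormalWord.Transversal fun i => Subgroup.inclusion (hKA i) :=
    { injective := fun i => Subgroup.inclusion_injective (hKA i)
      set := fun i => Subtype.val ⁻¹' T i
      one_mem := h1
      compl := fun i => (hT i).isComplement (hKA i) }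
  have hbase : ∀ x : K, F x = Monoid.PushoutI.base _ x := by
    intro x
    let i : ι := Classical.arbitrary ι
    rw [← Monoid.PushoutI.of_apply_eq_base _ i]
    exact hF i (Subgroup.inclusion (hKA i) x)
  have key : ∀ (κ : G), κ ∈ K → ∀ L : List (ι × G), IsReducedList T L →
      ∃ w : Monoid.PushoutI.NormalWord d, (w.head : G) = κ ∧
        w.toList.map (fun x => (x.1, (x.2 : G))) = L ∧
        w.prod = F (κ * (L.map Prod.snd).prod) := by
    intro κ hκ L hL
    obtain ⟨W, rfl⟩ : ∃ W : List (Σ i, A i), W.map (fun x => (x.1, (x.2 : G))) = L := by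
      refine ⟨L.pmap (fun x hx => ⟨x.1, x.2, hx⟩) fun x hx => (hT _).1 (hL.1 x hx).2, ?_⟩
      simp [List.map_pmap]
    have hmem : ∀ x ∈ W, (x.2 : G) ≠ 1 ∧ (x.2 : G) ∈ T x.1 := fun x hx =>
      hL.1 _ (List.mem_map_of_mem hx)
    refine ⟨{ toList := W
              ne_one := fun x hx hx1 => (hmem x hx).1 (by rw [hx1]; rfl)
              chain_ne := (List.isChain_map fun x : Σ i, A i => (x.1, (x.2 : G))).1 hL.2
              head := ⟨κ, hκ⟩
              normalized := fun i g hg => (hmem _ hg).2 }, rfl, rfl, ?_⟩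
    simp only [Monoid.PushoutI.NormalWord.prod, Monoid.CoprodI.Word.prod, map_mul,
      map_list_prod, List.map_map]
    congr 1
    · exact (hbase ⟨κ, hκ⟩).symm
    · congr 1
      refine List.map_congr_left fun x _ => ?_
      simp only [Function.comp_apply, Monoid.PushoutI.ofCoprodI_of]
      exact (hF x.1 x.2).symm
  obtain ⟨w, hw, hwL, hwp⟩ := key κ hκ L hL
  obtain ⟨w', hw', hwL', hwp'⟩ := key κ' hκ' L' hL'
  have : w = w' := Monoid.PushoutI.NormalWord.prod_injective (by rw [hwp, hwp', h])
  subst this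
  exact ⟨hw.symm.trans hw', hwL.symm.trans hwL'⟩

end Uniqueness

section Existence

variable {ι : Type*} {H : Subgroup G} {B : ι → Subgroup G} {S : ι → Set G}

theorem IsReducedList.exists_mul_prod (hS : ∀ i, IsRightTransversal H (B i) (S i))
    {i : ι} {b : G} (hb : b ∈ B i) {L : List (ι × G)} (hL : IsReducedList S L)
    (hi : ∀ x ∈ L.head?, i ≠ x.1) :
    ∃ κ ∈ H, ∃ L', IsReducedList S L' ∧
      b * (L.map Prod.snd).prod = κ * (L'.map Prod.snd).prod := by
  obtain ⟨κ, hκ, t, ht, rfl⟩ := (hS i).exists_mul hb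
  by_cases h : t = 1
  · exact ⟨κ, hκ, L, hL, by simp [h]⟩
  · refine ⟨κ, hκ, (i, t) :: L, ⟨?_, ?_⟩, by simp [mul_assoc]⟩
    · rintro x hx
      rcases List.mem_cons.1 hx with rfl | hx
      · exact ⟨h, ht⟩
      · exact hL.1 x hx
    · exact List.isChain_cons.2 ⟨hi, hL.2⟩

/-- Every element of the subgroup generated by the `B i` has a decomposition with respect to
right transversals of `H` in the `B i`. -/
theorem exists_isReducedList (hHB : ∀ i, H ≤ B i)
    (hS : ∀ i, IsRightTransversal H (B i) (S i)) {μ : G}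
    (hμ : μ ∈ Subgroup.closure (⋃ i, (B i : Set G))) :
    ∃ κ ∈ H, ∃ L, IsReducedList S L ∧ μ = κ * (L.map Prod.snd).prod := by
  have step : ∀ i, ∀ b ∈ B i, ∀ y : G,
      (∃ κ ∈ H, ∃ L, IsReducedList S L ∧ y = κ * (L.map Prod.snd).prod) →
      ∃ κ ∈ H, ∃ L, IsReducedList S L ∧ b * y = κ * (L.map Prod.snd).prod := by
    rintro i b hb _ ⟨κ, hκ, L, hL, rfl⟩
    have hbκ : b * κ ∈ B i := mul_mem hb (hHB i hκ)
    by_cases hi : ∀ x ∈ L.head?, i ≠ x.1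
    · rw [← mul_assoc]
      exact hL.exists_mul_prod hS hbκ hi
    · push Not at hi
      obtain ⟨⟨j, t⟩, hx, hij⟩ := hi
      obtain rfl : i = j := hij
      cases L with
      | nil => simp at hx
      | cons y L =>
        obtain rfl : y = (i, t) := by simpa using hx
        have ht : t ∈ B i := (hS i).1 (hL.1 (i, t) (by simp)).2
        have hchain := List.isChain_cons.1 hL.2
        have hL' : IsReducedList S L :=
          ⟨fun x hx => hL.1 x (List.mem_cons_of_mem _ hx), hchain.2⟩
        simpa [mul_assoc] using hL'.exists_mul_prod hS (mul_mem hbκ ht) hchain.1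
  induction hμ using Subgroup.closure_induction_left with
  | one => exact ⟨1, one_mem _, [], ⟨by simp, by simp⟩, by simp⟩
  | mul_left x hx y _ ih =>
    obtain ⟨i, hi⟩ := Set.mem_iUnion.1 hx
    exact step i x hi y ih
  | inv_mul_cancel x hx y _ ih =>
    obtain ⟨i, hi⟩ := Set.mem_iUnion.1 hx
    exact step i x⁻¹ (inv_mem hi) y ih

end Existence

theorem closure_qgen_le (n j : ℕ) (α : ℕ → G) (β : G) :
    Subgroup.closure (α '' {i | j ≤ i ∧ i < n - 1}) ≤
      Subgroup.closure (qgen n α β '' {i | j ≤ i ∧ i < n}) := by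
  refine Subgroup.closure_mono ?_
  rintro _ ⟨i, ⟨hji, hin⟩, rfl⟩
  exact ⟨i, ⟨hji, by omega⟩, if_neg (by omega)⟩

theorem subset_zero_of_nested {X : Type*} {T : ℕ → Set X} {N : ℕ}
    (h : ∀ j, j + 1 ≤ N → T (j + 1) ⊆ T j)
    {j : ℕ} (hj : j ≤ N) : T j ⊆ T 0 := by
  induction j with
  | zero => exact subset_rfl
  | succ j ih => exact (h j hj).trans (ih (by omega))

/-- Lemma `indtrans`: with nested transversals `TPf`, `TQf` as in Lemma `utrans`
(`TPf j` a right transversal of `⟨α j,…,α (n-2)⟩` in `⟨α j,…,α (n-1)⟩` contained in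
`TPf 0 = T_P`, and `TQf j` one of `⟨α j,…,α (n-2)⟩` in `⟨α j,…,α (n-2),β⟩` contained in
`TQf 0 = T_Q`, with `TPf (n-1) = {1, α (n-1)}`, `TQf (n-1) = {1, β}`), if `μ` lies in
`Π_j^+ = ⟨α (j+1), …, α (n-1), β⟩` (here written with `j' = j + 1`, `-1 ≤ j ≤ n-2`) and
`μ = κ * τ 0 * ⋯ * τ (m-1)` is a reduced decomposition relative to `TPf 0`, `TQf 0`, then
`κ ∈ ⟨α (j+1), …, α (n-2)⟩` and each `τ i ∈ TPf (j+1) ∪ TQf (j+1)`. -/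
theorem reduced_decomposition_in_tail_subgroup
    (n : ℕ) (α : ℕ → G) (β : G) (h2 : 2 ≤ n)
    (hP : IsStringCFamily n α) (hQ : IsStringCFamily n (qgen n α β))
    (hAm : IsAmalgam (ΓP n α) (ΓQ n α β) (ΓK n α))
    (TPf TQf : ℕ → Set G)
    (hTPnest : ∀ j : ℕ, j + 1 ≤ n - 1 → TPf (j + 1) ⊆ TPf j)
    (hTQnest : ∀ j : ℕ, j + 1 ≤ n - 1 → TQf (j + 1) ⊆ TQf j)
    (hTPlast : TPf (n - 1) = {1, α (n - 1)})
    (hTQlast : TQf (n - 1) = {1, β})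
    (hTP : ∀ j < n, IsRightTransversal
      (Subgroup.closure (α '' {i | j ≤ i ∧ i < n - 1}))
      (Subgroup.closure (α '' {i | j ≤ i ∧ i < n})) (TPf j))
    (hTQ : ∀ j < n, IsRightTransversal
      (Subgroup.closure (α '' {i | j ≤ i ∧ i < n - 1}))
      (Subgroup.closure (qgen n α β '' {i | j ≤ i ∧ i < n})) (TQf j))
    (j' : ℕ) (hj' : j' ≤ n - 1)
    (μ κ : G) (m : ℕ) (τ : Fin m → G)
    (hμ : μ ∈ Subgroup.closure
      (α '' {i | j' ≤ i ∧ i < n} ∪ qgen n α β '' {i | j' ≤ i ∧ i < n}))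
    (hdec : IsReducedDecomp (ΓK n α) (TPf 0) (TQf 0) μ κ m τ) :
    κ ∈ Subgroup.closure (α '' {i | j' ≤ i ∧ i < n - 1}) ∧
    ∀ i : Fin m, τ i ∈ TPf j' ∪ TQf j' := by
  obtain ⟨hκ, rfl, side, hside, halt⟩ := hdec
  obtain ⟨hKP, hKQ, -, hext⟩ := hAm
  have hTP0 : IsRightTransversal (ΓK n α) (ΓP n α) (TPf 0) := by
    simpa [ΓK, ΓP, Set.Iio] using hTP 0 (by omega)
  have hTQ0 : IsRightTransversal (ΓK n α) (ΓQ n α β) (TQf 0) := by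
    simpa [ΓK, ΓQ, Set.Iio] using hTQ 0 (by omega)
  let A : Bool → Subgroup G := fun b => if b then ΓP n α else ΓQ n α β
  let T : ℕ → Bool → Set G := fun j b => if b then TPf j else TQf j
  let B : Bool → Subgroup G := fun b =>
    if b then Subgroup.closure (α '' {i | j' ≤ i ∧ i < n})
    else Subgroup.closure (qgen n α β '' {i | j' ≤ i ∧ i < n})
  have hKA : ∀ b, ΓK n α ≤ A b := Bool.rec hKQ hKP
  have hT : ∀ b, IsRightTransversal (ΓK n α) (A b) (T 0 b) := Bool.rec hTQ0 hTP0
  have h1 : ∀ b, (1 : G) ∈ T 0 b :=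
    Bool.rec (subset_zero_of_nested hTQnest le_rfl (by simp [hTQlast]))
      (subset_zero_of_nested hTPnest le_rfl (by simp [hTPlast]))
  obtain ⟨F, hFP, hFQ⟩ := hext (Monoid.PushoutI fun b => Subgroup.inclusion (hKA b))
    (Monoid.PushoutI.of (φ := fun b => Subgroup.inclusion (hKA b)) true)
    (Monoid.PushoutI.of (φ := fun b => Subgroup.inclusion (hKA b)) false)
    (fun x _ _ hxK =>
      (Monoid.PushoutI.of_apply_eq_base (fun b => Subgroup.inclusion (hKA b)) true
        ⟨x, hxK⟩).trans
      (Monoid.PushoutI.of_apply_eq_base (fun b => Subgroup.inclusion (hKA b)) false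
        ⟨x, hxK⟩).symm)
  have hF : ∀ b (x : A b), F x = Monoid.PushoutI.of b x := Bool.rec hFQ hFP
  have hHB : ∀ b, Subgroup.closure (α '' {i | j' ≤ i ∧ i < n - 1}) ≤ B b :=
    Bool.rec (closure_qgen_le n j' α β) <| Subgroup.closure_mono <| Set.image_mono
      fun i hi => ⟨hi.1, by have := hi.2; omega⟩
  have hS : ∀ b, IsRightTransversal (Subgroup.closure (α '' {i | j' ≤ i ∧ i < n - 1}))
      (B b) (T j' b) := Bool.rec (hTQ j' (by omega)) (hTP j' (by omega))
  have hST : ∀ b, T j' b ⊆ T 0 b :=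
    Bool.rec (subset_zero_of_nested hTQnest hj') (subset_zero_of_nested hTPnest hj')
  obtain ⟨κ', hκ', L', hL', hμ'⟩ := exists_isReducedList hHB hS <|
    Subgroup.closure_mono (Set.union_subset
      (Subgroup.subset_closure.trans (Set.subset_iUnion (fun b => (B b : Set G)) true))
      (Subgroup.subset_closure.trans (Set.subset_iUnion (fun b => (B b : Set G)) false))) hμ
  have hL : IsReducedList (T 0) (List.ofFn fun i => (side i, τ i)) := by
    refine ⟨?_, ?_⟩
    · intro x hx
      obtain ⟨i, rfl⟩ := List.mem_ofFn.1 hx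
      exact hside i
    · rw [List.isChain_iff_getElem]
      intro i hi
      simpa using halt i (by simpa using hi)
  have hκK : κ' ∈ ΓK n α :=
    Subgroup.closure_mono (Set.image_mono fun _ hi => hi.2) hκ'
  obtain ⟨rfl, rfl⟩ := IsReducedList.unique hKA hT h1 F hF hκ hκK hL
    ⟨fun x hx => ⟨(hL'.1 x hx).1, hST _ (hL'.1 x hx).2⟩, hL'.2⟩
    (by rw [← hμ', List.map_ofFn]; rfl)
  refine ⟨hκ', fun i => ?_⟩
  have hi : τ i ∈ T j' (side i) := (hL'.1 (side i, τ i) (List.mem_ofFn.2 ⟨i, rfl⟩)).2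
  cases hs : side i
  · exact Or.inr (by simpa [T, hs] using hi)
  · exact Or.inl (by simpa [T, hs] using hi)

end Amalgam
end

section
/- Let Π = Γ(P) *_{Γ(K)} Γ(Q) be the amalgamated free product of string C-groups Γ(P) and Γ(Q) of rank n ≥ 2 along their common facet subgroup Γ(K). Then Π satisfies the intersection condition on the generating family α_0, …, α_{n−2}, α_{n−1}, β_{n−1}: for all subsets I, J of the index set of this family, ⟨I⟩ ∩ ⟨J⟩ = ⟨I ∩ J⟩ as subgroups of Π. In particular, Γ(P) ∩ Γ(Q) = Γ(K) inside Π, and Π is a tail-triangle C-group. -/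
/-!
The amalgamated free product `Π = Γ(P) *_{Γ(K)} Γ(Q)` of two string C-groups of rank
`n ≥ 2` along their common facet subgroup `Γ(K) = ⟨α 0, …, α (n-2)⟩`.  We work inside the
group `Π`, in which `Γ(P) = ⟨α 0, …, α (n-1)⟩` and `Γ(Q) = ⟨α 0, …, α (n-2), β⟩` are
identified with their images; being an amalgam is expressed by the pushout universal
property together with the fact that `Γ(P)` and `Γ(Q)` generate `Π`.
-/

universe u

namespace Amalgam

variable {G : Type u} [Group G]

/-- The combined generating family: index `i < n` gives `α i`, index `n` (or beyond) gives `β`. -/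
def ttGens (n : ℕ) (α : ℕ → G) (β : G) : ℕ → G := fun i => if i < n then α i else β

/-- The intersection condition on the generating family, for subsets of the index set `Iic n`. -/
def ttInterCond (n : ℕ) (α : ℕ → G) (β : G) : Prop :=
  ∀ I J : Set ℕ, I ⊆ Set.Iic n → J ⊆ Set.Iic n →
    Subgroup.closure (ttGens n α β '' I) ⊓ Subgroup.closure (ttGens n α β '' J)
      = Subgroup.closure (ttGens n α β '' (I ∩ J))

/-- A tail-triangle group of rank `n+1`. -/
structure IsTailTriangleGroup (n : ℕ) (α : ℕ → G) (β : G) : Prop where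
  two_le : 2 ≤ n
  orderOf_α : ∀ i < n, orderOf (α i) = 2
  orderOf_β : orderOf β = 2
  comm_αα : ∀ i j : ℕ, i + 2 ≤ j → j < n → Commute (α i) (α j)
  comm_αβ : ∀ i : ℕ, i + 3 ≤ n → Commute (α i) β
  closure_eq_top : Subgroup.closure (ttGens n α β '' Set.Iic n) = ⊤

/-- A tail-triangle C-group: a tail-triangle group satisfying the intersection condition. -/
def IsTailTriangleCGroup (n : ℕ) (α : ℕ → G) (β : G) : Prop :=
  IsTailTriangleGroup n α β ∧ ttInterCond n α β

section AlternatingProducts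

/-- Nonempty alternating products `x₁ * ⋯ * xₖ` whose factors lie alternately in `L true` and
`L false`, with no factor in `K`; the index records which subgroup contains the first factor. -/
inductive AltProd (L : Bool → Subgroup G) (K : Subgroup G) : Bool → G → Prop
  | single {i : Bool} {x : G} (hx : x ∈ L i) (hxK : x ∉ K) : AltProd L K i x
  | cons {i : Bool} {x g : G} (hx : x ∈ L i) (hxK : x ∉ K) (hg : AltProd L K (!i) g) :
      AltProd L K i (x * g)

variable {L M : Bool → Subgroup G} {K : Subgroup G}

theorem AltProd.mono (hML : ∀ i, M i ≤ L i) {i : Bool} {g : G} (h : AltProd M K i g) :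
    AltProd L K i g := by
  induction h with
  | single hx hxK => exact .single (hML _ hx) hxK
  | cons hx hxK _ ih => exact .cons (hML _ hx) hxK ih

theorem AltProd.mul_left_of_mem {i : Bool} {c g : G} (hc : c ∈ L i) (hcK : c ∈ K)
    (h : AltProd L K i g) : AltProd L K i (c * g) := by
  cases h with
  | single hx hxK =>
    exact .single (mul_mem hc hx) fun h => hxK ((K.mul_mem_cancel_left hcK).1 h)
  | cons hx hxK hg =>
    rw [← mul_assoc]
    exact .cons (mul_mem hc hx) (fun h => hxK ((K.mul_mem_cancel_left hcK).1 h)) hg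

theorem AltProd.mul_left (hLK : ∀ i j, L i ⊓ K ≤ L j) {i j : Bool} {x g : G} (hx : x ∈ L i)
    (h : AltProd L K j g) :
    (x * g ∈ K ∧ ∀ k, x * g ∈ L k) ∨ ∃ k, AltProd L K k (x * g) := by
  by_cases hij : j = i
  · subst hij
    cases h with
    | single hy hyK =>
      by_cases hK : x * g ∈ K
      · exact .inl ⟨hK, fun k => hLK j k ⟨mul_mem hx hy, hK⟩⟩
      · exact .inr ⟨j, .single (mul_mem hx hy) hK⟩
    | @cons _ y h hy hyK hh =>
      rw [← mul_assoc]
      by_cases hK : x * y ∈ K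
      · exact .inr ⟨!j, hh.mul_left_of_mem (hLK j _ ⟨mul_mem hx hy, hK⟩) hK⟩
      · exact .inr ⟨j, .cons (mul_mem hx hy) hK hh⟩
  · obtain rfl : j = !i := by cases i <;> cases j <;> simp_all
    by_cases hK : x ∈ K
    · exact .inr ⟨!i, h.mul_left_of_mem (hLK i _ ⟨hx, hK⟩) hK⟩
    · exact .inr ⟨i, .cons hx hK h⟩

/-- If `L true` and `L false` have the same intersection with `K`, then every element of the
subgroup they generate lies in that intersection or is an alternating product. -/
theorem mem_or_altProd_of_mem_iSup (hLK : ∀ i j, L i ⊓ K ≤ L j) {g : G} (hg : g ∈ ⨆ i, L i) :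
    (g ∈ K ∧ ∀ i, g ∈ L i) ∨ ∃ i, AltProd L K i g := by
  rw [Subgroup.iSup_eq_closure] at hg
  have step : ∀ x ∈ ⋃ i, (L i : Set G), ∀ y : G,
      ((y ∈ K ∧ ∀ i, y ∈ L i) ∨ ∃ i, AltProd L K i y) →
      ((x * y ∈ K ∧ ∀ i, x * y ∈ L i) ∨ ∃ i, AltProd L K i (x * y)) := by
    intro x hx y hy
    obtain ⟨i, hx⟩ := Set.mem_iUnion.1 hx
    obtain ⟨_, hyL⟩ | ⟨j, hy⟩ := hy
    · have hxy : x * y ∈ L i := mul_mem hx (hyL i)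
      by_cases hK : x * y ∈ K
      · exact .inl ⟨hK, fun k => hLK i k ⟨hxy, hK⟩⟩
      · exact .inr ⟨i, .single hxy hK⟩
    · exact hy.mul_left hLK hx
  induction hg using Subgroup.closure_induction_left with
  | one => exact .inl ⟨one_mem _, fun _ => one_mem _⟩
  | mul_left x hx y _ ih => exact step x hx y ih
  | inv_mul_cancel x hx y _ ih =>
    refine step _ ?_ y ih
    simpa using hx

end AlternatingProducts

section Amalgam

open Monoid

variable {L M : Bool → Subgroup G} {K : Subgroup G}

/-- In an amalgamated free product, no alternating product lies in the amalgamated subgroup. -/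
theorem IsAmalgam.altProd_notMem (h : IsAmalgam (L true) (L false) K) {i : Bool} {g : G}
    (hg : AltProd L K i g) : g ∉ K := by
  obtain ⟨hKP, hKQ, -, hlift⟩ := h
  have hKL : ∀ i, K ≤ L i := Bool.forall_bool.2 ⟨hKQ, hKP⟩
  let φ : ∀ i, K →* L i := fun i => Subgroup.inclusion (hKL i)
  have hφ : ∀ i, Function.Injective (φ i) := fun i => Subgroup.inclusion_injective (hKL i)
  obtain ⟨F, hFP, hFQ⟩ := hlift (PushoutI φ) (PushoutI.of (φ := φ) true)
    (PushoutI.of (φ := φ) false)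
    (fun x _ _ hxK => (PushoutI.of_apply_eq_base φ true ⟨x, hxK⟩).trans
      (PushoutI.of_apply_eq_base φ false ⟨x, hxK⟩).symm)
  have hF : ∀ i (x : L i), F x = PushoutI.of (φ := φ) i x := Bool.forall_bool.2 ⟨hFQ, hFP⟩
  have hφK : ∀ {i} {x : G} (hx : x ∈ L i), x ∉ K → (⟨x, hx⟩ : L i) ∉ (φ i).range := by
    rintro i x hx hxK ⟨y, hy⟩
    have hyx : (y : G) = x := congrArg Subtype.val hy
    exact hxK (hyx ▸ y.2)
  have hword : ∃ w : CoprodI.Word fun i => L i, PushoutI.Reduced φ w ∧ w.fstIdx = some i ∧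
      PushoutI.ofCoprodI w.prod = F g := by
    induction hg with
    | @single i x hx hxK =>
      have h0 : (CoprodI.Word.empty : CoprodI.Word fun i => L i).fstIdx ≠ some i := by
        simp [CoprodI.Word.fstIdx, CoprodI.Word.empty]
      have h1 : (⟨x, hx⟩ : L i) ≠ 1 := fun h => hφK hx hxK (h ▸ one_mem _)
      refine ⟨CoprodI.Word.cons ⟨x, hx⟩ CoprodI.Word.empty h0 h1, ?_, ?_, ?_⟩
      · intro y hy
        simp only [CoprodI.Word.cons, CoprodI.Word.empty, List.mem_singleton] at hy
        subst hy
        exact hφK hx hxK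
      · rfl
      · rw [CoprodI.Word.prod_cons, CoprodI.Word.prod_empty, mul_one, PushoutI.ofCoprodI_of, ← hF]
    | @cons i x g hx hxK _ ih =>
      obtain ⟨w, hw, hwi, hwg⟩ := ih
      have h0 : w.fstIdx ≠ some i := by simp [hwi]
      have h1 : (⟨x, hx⟩ : L i) ≠ 1 := fun h => hφK hx hxK (h ▸ one_mem _)
      refine ⟨CoprodI.Word.cons ⟨x, hx⟩ w h0 h1, ?_, ?_, ?_⟩
      · intro y hy
        simp only [CoprodI.Word.cons, List.mem_cons] at hy
        obtain rfl | hy := hy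
        · exact hφK hx hxK
        · exact hw y hy
      · rfl
      · rw [CoprodI.Word.prod_cons, map_mul, PushoutI.ofCoprodI_of, ← hF, hwg, map_mul]
  intro hgK
  obtain ⟨w, hw, hwi, hwg⟩ := hword
  have hbase : PushoutI.ofCoprodI w.prod ∈ (PushoutI.base φ).range :=
    ⟨⟨g, hgK⟩, by
      rw [hwg, ← PushoutI.of_apply_eq_base φ i, ← hF]
      rfl⟩
  rw [hw.eq_empty_of_mem_range hφ hbase] at hwi
  simp [CoprodI.Word.fstIdx, CoprodI.Word.empty] at hwi

/-- In an amalgamated free product, subgroups `M i` of the factors `L i` having the same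
intersection with the amalgamated subgroup generate a subgroup meeting `L i` in `M i`. -/
theorem IsAmalgam.iSup_inf_le (h : IsAmalgam (L true) (L false) K) (hML : ∀ i, M i ≤ L i)
    (hMK : ∀ i j, M i ⊓ K ≤ M j) (i : Bool) : (⨆ j, M j) ⊓ L i ≤ M i := by
  rintro g ⟨hg, hgL⟩
  have key : ∀ {g : G}, g ∈ L i → ¬ AltProd L K (!i) g := by
    intro g hgL hg
    have hgK := h.altProd_notMem hg
    refine h.altProd_notMem (.cons (x := g⁻¹) (i := i) (inv_mem hgL) ?_ hg) ?_
    · rwa [inv_mem_iff]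
    · rw [inv_mul_cancel]
      exact one_mem K
  obtain ⟨_, hgM⟩ | ⟨j, hg⟩ := mem_or_altProd_of_mem_iSup hMK hg
  · exact hgM i
  by_cases hij : j = i
  · subst hij
    cases hg with
    | single hx _ => exact hx
    | cons hx _ hh =>
      exact absurd (hh.mono hML) (key ((mul_mem_cancel_left (hML _ hx)).1 hgL))
  · obtain rfl : j = !i := by cases i <;> cases j <;> simp_all
    exact absurd (hg.mono hML) (key hgL)

end Amalgam

section Generators

open Subgroup

/-- If the images under `t` of two sets of indices commute elementwise, then every element of the
subgroup generated by their union factors as a product. -/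
theorem exists_mul_of_mem_closure_image_union {t : ℕ → G} {S T : Set ℕ}
    (hST : ∀ i ∈ S, ∀ j ∈ T, Commute (t i) (t j)) {g : G} (hg : g ∈ closure (t '' (S ∪ T))) :
    ∃ u ∈ closure (t '' S), ∃ v ∈ closure (t '' T), u * v = g := by
  have hle : closure (t '' S) ≤ centralizer (closure (t '' T) : Set G) := by
    rw [centralizer_closure, closure_le]
    rintro _ ⟨i, hi, rfl⟩
    rw [SetLike.mem_coe, mem_centralizer_iff]
    rintro _ ⟨j, hj, rfl⟩
    exact (hST i hi j hj).symm.eq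
  rw [Set.image_union, Subgroup.closure_union, ← SetLike.mem_coe,
    coe_mul_of_left_le_normalizer_right _ _ (hle.trans (centralizer_le_normalizer _))] at hg
  exact Set.mem_mul.1 hg

variable {n : ℕ} {α : ℕ → G} {β : G}

/-- The indices, in the combined family `ttGens n α β`, of the generators of `Γ(P)` (for `true`)
and of `Γ(Q)` (for `false`). -/
def factorIdx (n : ℕ) : Bool → Set ℕ
  | true => Set.Iio n
  | false => Set.Iic n \ {n - 1}

theorem ttGens_of_lt {X : Type*} {n : ℕ} {α : ℕ → X} {β : X} {i : ℕ} (hi : i < n) : ttGens n α β i = α i := if_pos hi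

theorem ttGens_self {X : Type*} {n : ℕ} {α : ℕ → X} {β : X} : ttGens n α β n = β := if_neg (lt_irrefl n)

theorem ttGens_image_of_subset {X : Type*} {n : ℕ} {α : ℕ → X} {β : X} {S : Set ℕ}
    (hS : S ⊆ Set.Iio n) : ttGens n α β '' S = α '' S :=
  Set.image_congr fun _ hi => ttGens_of_lt (hS hi)

theorem qgen_swap {X : Type*} {n : ℕ} {α : ℕ → X} {β : X} (hn : 1 ≤ n) {i : ℕ}
    (hi : i ∈ factorIdx n false) :
    qgen n α β (Equiv.swap (n - 1) n i) = ttGens n α β i := by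
  obtain ⟨hin, hi1⟩ := hi
  simp only [Set.mem_Iic, Set.mem_singleton_iff] at hin hi1
  by_cases h : i = n
  · subst h
    simp [qgen, ttGens]
  · rw [Equiv.swap_apply_of_ne_of_ne hi1 h, qgen, if_neg hi1, ttGens_of_lt (by omega)]

theorem qgen_image_swap {X : Type*} {n : ℕ} {α : ℕ → X} {β : X} (hn : 1 ≤ n) {S : Set ℕ}
    (hS : S ⊆ factorIdx n false) :
    qgen n α β '' (Equiv.swap (n - 1) n '' S) = ttGens n α β '' S := by
  rw [Set.image_image]
  exact Set.image_congr fun _ hi => qgen_swap hn (hS hi)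

theorem swap_image_factorIdx (hn : 1 ≤ n) :
    Equiv.swap (n - 1) n '' factorIdx n false = Set.Iio n := by
  ext i
  rw [Equiv.image_eq_preimage_symm, Equiv.symm_swap, Set.mem_preimage, Equiv.swap_apply_def]
  simp only [factorIdx, Set.mem_sdiff, Set.mem_Iic, Set.mem_singleton_iff, Set.mem_Iio]
  split_ifs <;> omega

theorem ΓP_eq : ΓP n α = closure (ttGens n α β '' factorIdx n true) := by
  rw [factorIdx, ttGens_image_of_subset subset_rfl, ΓP]

theorem ΓQ_eq (hn : 1 ≤ n) : ΓQ n α β = closure (ttGens n α β '' factorIdx n false) := by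
  rw [← qgen_image_swap hn subset_rfl, swap_image_factorIdx hn, ΓQ]

theorem ΓK_eq : ΓK n α = closure (ttGens n α β '' Set.Iio (n - 1)) := by
  rw [ttGens_image_of_subset (Set.Iio_subset_Iio (Nat.sub_le n 1)), ΓK]

theorem factorIdx_union (hn : 1 ≤ n) : factorIdx n true ∪ factorIdx n false = Set.Iic n := by
  ext i
  simp only [factorIdx, Set.mem_union, Set.mem_sdiff, Set.mem_Iic, Set.mem_singleton_iff,
    Set.mem_Iio]
  omega

theorem factorIdx_inter : factorIdx n true ∩ factorIdx n false = Set.Iio (n - 1) := by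
  ext i
  simp only [factorIdx, Set.mem_inter_iff, Set.mem_sdiff, Set.mem_Iic, Set.mem_singleton_iff,
    Set.mem_Iio]
  omega

theorem Iio_subset_factorIdx (i : Bool) : Set.Iio (n - 1) ⊆ factorIdx n i := by
  rw [← factorIdx_inter]
  cases i
  · exact Set.inter_subset_right
  · exact Set.inter_subset_left

/-- The intersection condition inside each of the two factors. -/
theorem closure_inf_closure_of_subset_factorIdx (hn : 1 ≤ n) (hP : stringInterCond n α)
    (hQ : stringInterCond n (qgen n α β)) (i : Bool) {S T : Set ℕ} (hS : S ⊆ factorIdx n i)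
    (hT : T ⊆ factorIdx n i) :
    closure (ttGens n α β '' S) ⊓ closure (ttGens n α β '' T)
      = closure (ttGens n α β '' (S ∩ T)) := by
  cases i with
  | true =>
    rw [ttGens_image_of_subset hS, ttGens_image_of_subset hT,
      ttGens_image_of_subset (Set.inter_subset_left.trans hS)]
    exact hP S T hS hT
  | false =>
    rw [← qgen_image_swap hn hS, ← qgen_image_swap hn hT,
      ← qgen_image_swap hn (Set.inter_subset_left.trans hS),
      Set.image_inter (Equiv.injective _)]
    refine hQ _ _ ?_ ?_ <;> rw [← swap_image_factorIdx hn] <;> exact Set.image_mono ‹_›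

/-- The intersection condition when one of the two subsets generates a subgroup of a factor. -/
theorem closure_inf_closure_le_of_subset_factorIdx (hn : 1 ≤ n) (hP : stringInterCond n α)
    (hQ : stringInterCond n (qgen n α β)) (hAm : IsAmalgam (ΓP n α) (ΓQ n α β) (ΓK n α))
    (i : Bool) {I J : Set ℕ} (hI : I ⊆ factorIdx n i) (hJ : J ⊆ Set.Iic n) :
    closure (ttGens n α β '' I) ⊓ closure (ttGens n α β '' J)
      ≤ closure (ttGens n α β '' (I ∩ J)) := by
  have hinter := closure_inf_closure_of_subset_factorIdx hn hP hQ
  rw [ΓP_eq (β := β), ΓQ_eq hn, ΓK_eq (β := β)] at hAm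
  have hJ' : closure (ttGens n α β '' J) =
      ⨆ j, closure (ttGens n α β '' (J ∩ factorIdx n j)) := by
    rw [iSup_bool_eq, ← Subgroup.closure_union, ← Set.image_union, ← Set.inter_union_distrib_left,
      factorIdx_union hn, Set.inter_eq_left.2 hJ]
  have hmeet := IsAmalgam.iSup_inf_le (L := fun j => closure (ttGens n α β '' factorIdx n j))
    (M := fun j => closure (ttGens n α β '' (J ∩ factorIdx n j))) hAm
    (fun j => closure_mono (Set.image_mono Set.inter_subset_right))
    (fun j k => by
      rw [hinter j Set.inter_subset_right (Iio_subset_factorIdx j)]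
      refine closure_mono (Set.image_mono ?_)
      exact Set.inter_subset_inter Set.inter_subset_left (Iio_subset_factorIdx k)) i
  rintro g ⟨hgI, hgJ⟩
  have hgM := hmeet ⟨hJ' ▸ hgJ, closure_mono (Set.image_mono hI) hgI⟩
  have := (hinter i hI Set.inter_subset_right).le ⟨hgI, hgM⟩
  exact closure_mono (Set.image_mono
    (Set.inter_subset_inter_right I Set.inter_subset_left)) this

theorem ttGens_commute (hαα : ∀ i j : ℕ, i + 2 ≤ j → j < n → Commute (α i) (α j))
    (hαβ : ∀ i : ℕ, i + 3 ≤ n → Commute (α i) β) {i j : ℕ} (hij : i + 2 ≤ j) (hi : i + 3 ≤ n)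
    (hj : j ≤ n) : Commute (ttGens n α β i) (ttGens n α β j) := by
  rw [ttGens_of_lt (by omega)]
  obtain rfl | hj := hj.eq_or_lt
  · rw [ttGens_self]
    exact hαβ i hi
  · rw [ttGens_of_lt hj]
    exact hαα i j hij hj

/-- If `Set.Icc m n` is contained in `I ∩ J`, with `m < n` and `m - 1 ∉ I`, then the intersection
condition for `I` and `J` follows from the one for `I ∩ Set.Iio m` and `J`. -/
theorem closure_inf_closure_le_of_Icc_subset
    (hαα : ∀ i j : ℕ, i + 2 ≤ j → j < n → Commute (α i) (α j))
    (hαβ : ∀ i : ℕ, i + 3 ≤ n → Commute (α i) β) {I J : Set ℕ} (hI : I ⊆ Set.Iic n) {m : ℕ}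
    (hm : m < n) (hmI : Set.Icc m n ⊆ I) (hmJ : Set.Icc m n ⊆ J) (hpred : ∀ i ∈ I, i + 1 ≠ m)
    (hinter : closure (ttGens n α β '' (I ∩ Set.Iio m)) ⊓ closure (ttGens n α β '' J)
      ≤ closure (ttGens n α β '' (I ∩ Set.Iio m ∩ J))) :
    closure (ttGens n α β '' I) ⊓ closure (ttGens n α β '' J)
      ≤ closure (ttGens n α β '' (I ∩ J)) := by
  rintro g ⟨hgI, hgJ⟩
  have hsplit : I = (I ∩ Set.Iio m) ∪ Set.Icc m n := by
    ext i
    simp only [Set.mem_union, Set.mem_inter_iff, Set.mem_Iio, Set.mem_Icc]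
    refine ⟨fun hi => ?_, fun hi => hi.elim And.left fun hi => hmI hi⟩
    have : i ≤ n := hI hi
    by_cases him : i < m
    · exact .inl ⟨hi, him⟩
    · exact .inr ⟨by omega, this⟩
  rw [hsplit] at hgI
  obtain ⟨u, hu, v, hv, rfl⟩ := exists_mul_of_mem_closure_image_union (by
    rintro i ⟨hi, him⟩ j ⟨hmj, hjn⟩
    have := hpred i hi
    rw [Set.mem_Iio] at him
    exact ttGens_commute hαα hαβ (by omega) (by omega) hjn) hgI
  have huJ : u ∈ closure (ttGens n α β '' J) :=
    (mul_mem_cancel_right (closure_mono (Set.image_mono hmJ) hv)).1 hgJ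
  refine mul_mem ?_ (closure_mono (Set.image_mono (Set.subset_inter hmI hmJ)) hv)
  exact closure_mono (Set.image_mono (Set.inter_subset_inter_left J Set.inter_subset_left))
    (hinter ⟨hu, huJ⟩)

/-- A set of indices containing `n - 1` and `n` contains a maximal interval `Set.Icc m n`. -/
theorem exists_Icc_subset {n : ℕ} (hn : 1 ≤ n) {I : Set ℕ} (h1 : n - 1 ∈ I) (h2 : n ∈ I) :
    ∃ m < n, Set.Icc m n ⊆ I ∧ ∀ i ∈ I, i + 1 ≠ m := by
  classical
  have hbase : Set.Icc (n - 1) n ⊆ I := by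
    rintro i ⟨hi1, hi2⟩
    obtain rfl | rfl : i = n - 1 ∨ i = n := by omega
    · exact h1
    · exact h2
  have hex : ∃ m, Set.Icc m n ⊆ I := ⟨_, hbase⟩
  refine ⟨Nat.find hex, ?_, Nat.find_spec hex, fun i hi him => ?_⟩
  · have := Nat.find_min' hex hbase
    omega
  · refine Nat.find_min hex (m := i) (by omega) ?_
    rintro j ⟨hij, hjn⟩
    obtain rfl | hij := hij.eq_or_lt
    · exact hi
    · exact Nat.find_spec hex ⟨by omega, hjn⟩

/-- A set of indices omitting `n - 1` or `n` is contained in the index set of a factor. -/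
theorem exists_subset_factorIdx {I : Set ℕ} (hI : I ⊆ Set.Iic n) (h : ¬ (n - 1 ∈ I ∧ n ∈ I)) :
    ∃ i, I ⊆ factorIdx n i := by
  by_cases hn : n ∈ I
  · exact ⟨false, fun j hj => ⟨hI hj, fun hj1 => h ⟨hj1 ▸ hj, hn⟩⟩⟩
  · exact ⟨true, fun j hj => lt_of_le_of_ne (hI hj) fun hjn : j = n => hn (hjn ▸ hj)⟩

theorem ttInterCond_of_isAmalgam (hn : 1 ≤ n) (hP : stringInterCond n α)
    (hQ : stringInterCond n (qgen n α β)) (hAm : IsAmalgam (ΓP n α) (ΓQ n α β) (ΓK n α))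
    (hαα : ∀ i j : ℕ, i + 2 ≤ j → j < n → Commute (α i) (α j))
    (hαβ : ∀ i : ℕ, i + 3 ≤ n → Commute (α i) β) : ttInterCond n α β := by
  intro I J hI hJ
  have hfac := closure_inf_closure_le_of_subset_factorIdx hn hP hQ hAm
  refine le_antisymm ?_ (le_inf (closure_mono (Set.image_mono Set.inter_subset_left))
    (closure_mono (Set.image_mono Set.inter_subset_right)))
  by_cases hIf : n - 1 ∈ I ∧ n ∈ I
  swap
  · obtain ⟨i, hi⟩ := exists_subset_factorIdx hI hIf
    exact hfac i hi hJ
  by_cases hJf : n - 1 ∈ J ∧ n ∈ J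
  swap
  · obtain ⟨i, hi⟩ := exists_subset_factorIdx hJ hJf
    rw [inf_comm, Set.inter_comm]
    exact hfac i hi hI
  have hred : ∀ {I J : Set ℕ} {m m' : ℕ}, I ⊆ Set.Iic n → J ⊆ Set.Iic n → m < n →
      Set.Icc m n ⊆ I → (∀ i ∈ I, i + 1 ≠ m) → Set.Icc m' n ⊆ J → m' ≤ m →
      closure (ttGens n α β '' I) ⊓ closure (ttGens n α β '' J)
        ≤ closure (ttGens n α β '' (I ∩ J)) := by
    intro I J m m' hI hJ hm hmI hpred hmJ hle
    refine closure_inf_closure_le_of_Icc_subset hαα hαβ hI hm hmI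
      ((Set.Icc_subset_Icc_left hle).trans hmJ) hpred (hfac true ?_ hJ)
    exact Set.inter_subset_right.trans (Set.Iio_subset_Iio hm.le)
  obtain ⟨m, hm, hmI, hpI⟩ := exists_Icc_subset hn hIf.1 hIf.2
  obtain ⟨m', hm', hmJ, hpJ⟩ := exists_Icc_subset hn hJf.1 hJf.2
  obtain hle | hle := le_total m' m
  · exact hred hI hJ hm hmI hpI hmJ hle
  · rw [inf_comm, Set.inter_comm]
    exact hred hJ hI hm' hmJ hpJ hmI hle

end Generators

/-- Lemma `univinter`: the amalgamated free product `Π = Γ(P) *_{Γ(K)} Γ(Q)` of string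
C-groups of rank `n ≥ 2` satisfies the intersection condition on the generating family
`α 0, …, α (n-1), β`; in particular `Γ(P) ∩ Γ(Q) = Γ(K)` inside `Π`, and `Π` is a
tail-triangle C-group. -/
theorem amalgam_satisfies_intersection_condition
    (n : ℕ) (α : ℕ → G) (β : G) (h2 : 2 ≤ n)
    (hP : IsStringCFamily n α) (hQ : IsStringCFamily n (qgen n α β))
    (hAm : IsAmalgam (ΓP n α) (ΓQ n α β) (ΓK n α)) :
    ttInterCond n α β ∧
    ΓP n α ⊓ ΓQ n α β = ΓK n α ∧
    IsTailTriangleCGroup n α β := by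
  have hn : 1 ≤ n := by omega
  have hqlast : qgen n α β (n - 1) = β := if_pos rfl
  have hαβ : ∀ i : ℕ, i + 3 ≤ n → Commute (α i) β := by
    intro i hi
    have h := hQ.comm i (n - 1) (by omega) (by omega)
    rwa [hqlast, qgen, if_neg (by omega)] at h
  have hinter := ttInterCond_of_isAmalgam hn hP.inter hQ.inter hAm hP.comm hαβ
  have hunion := factorIdx_union hn
  refine ⟨hinter, ?_, ⟨h2, hP.orderOf_gen, ?_, hP.comm, hαβ, ?_⟩, hinter⟩
  · rw [ΓP_eq (β := β), ΓQ_eq hn, ΓK_eq (β := β), ← factorIdx_inter]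
    exact hinter _ _ (hunion ▸ Set.subset_union_left) (hunion ▸ Set.subset_union_right)
  · rw [← hqlast]
    exact hQ.orderOf_gen (n - 1) (by omega)
  · rw [← hunion, Set.image_union, Subgroup.closure_union, ← ΓP_eq, ← ΓQ_eq hn]
    exact hAm.2.2.1

end Amalgam
end

section
/- Let Γ be the group presented by generators ρ_0, ρ_1, ρ_2, ρ_3 subject to the relations ρ_0² = ρ_1² = ρ_2² = ρ_3² = (ρ_0ρ_2)² = (ρ_0ρ_3)² = (ρ_2ρ_3)² = (ρ_0ρ_1)³ = (ρ_1ρ_2)³ = (ρ_1ρ_3)⁴ = (ρ_0ρ_1ρ_3)³ = (ρ_2ρ_1ρ_3)³ = 1 (the quotient of the affine Coxeter group of type B̃_3 by the two extra relations (ρ_0ρ_1ρ_3)³ = (ρ_2ρ_1ρ_3)³ = 1). Then Γ is a finite group of order 96. -/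
namespace Tomotope

/-- The generator `ρ i` of the free group on four letters. -/
def ρ (i : Fin 4) : FreeGroup (Fin 4) := FreeGroup.of i

/-- The relators of the tomotope group: the relations of the affine Coxeter group `B̃₃`,
`ρ₀² = ρ₁² = ρ₂² = ρ₃² = (ρ₀ρ₂)² = (ρ₀ρ₃)² = (ρ₂ρ₃)² = (ρ₀ρ₁)³ = (ρ₁ρ₂)³ = (ρ₁ρ₃)⁴ = 1`,
together with the two extra relations `(ρ₀ρ₁ρ₃)³ = (ρ₂ρ₁ρ₃)³ = 1`. -/
def tomotopeRels : Set (FreeGroup (Fin 4)) :=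
  {ρ 0 ^ 2, ρ 1 ^ 2, ρ 2 ^ 2, ρ 3 ^ 2,
   (ρ 0 * ρ 2) ^ 2, (ρ 0 * ρ 3) ^ 2, (ρ 2 * ρ 3) ^ 2,
   (ρ 0 * ρ 1) ^ 3, (ρ 1 * ρ 2) ^ 3, (ρ 1 * ρ 3) ^ 4,
   (ρ 0 * ρ 1 * ρ 3) ^ 3, (ρ 2 * ρ 1 * ρ 3) ^ 3}

open scoped Pointwise

section Group

variable {G : Type*} [Group G]

theorem mul_self_of_sq {a : G} (h : a ^ 2 = 1) : a * a = 1 := by rwa [sq] at h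

theorem commute_of_sq {a b : G} (ha : a ^ 2 = 1) (hb : b ^ 2 = 1) (hab : (a * b) ^ 2 = 1) :
    a * b = b * a := by
  have h : (a * b)⁻¹ = a * b := inv_eq_of_mul_eq_one_left (mul_self_of_sq hab)
  rw [← h, mul_inv_rev, inv_eq_of_mul_eq_one_left (mul_self_of_sq ha),
    inv_eq_of_mul_eq_one_left (mul_self_of_sq hb)]

theorem braid_of_pow_three {a b : G} (ha : a ^ 2 = 1) (hb : b ^ 2 = 1) (hab : (a * b) ^ 3 = 1) :
    a * b * a = b * a * b := by
  have h : (a * b * a)⁻¹ = b * a * b :=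
    inv_eq_of_mul_eq_one_right (by rw [← hab]; simp only [pow_succ, pow_zero, one_mul, mul_assoc])
  rw [← h, mul_inv_rev, mul_inv_rev, inv_eq_of_mul_eq_one_left (mul_self_of_sq ha),
    inv_eq_of_mul_eq_one_left (mul_self_of_sq hb), mul_assoc]

theorem mul_conj_of_hemioctahedron {a b d : G} (ha : a ^ 2 = 1) (hb : b ^ 2 = 1) (hd : d ^ 2 = 1)
    (had : (a * d) ^ 2 = 1) (hab : (a * b) ^ 3 = 1) (hbd : (b * d) ^ 4 = 1)
    (habd : (a * b * d) ^ 3 = 1) : a * (b * d * b) = d * (b * d * b) * a := by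
  have ha' := inv_eq_of_mul_eq_one_left (mul_self_of_sq ha)
  have hb' := inv_eq_of_mul_eq_one_left (mul_self_of_sq hb)
  have hd' := inv_eq_of_mul_eq_one_left (mul_self_of_sq hd)
  have hcomm := commute_of_sq ha hd had
  have hbraid := braid_of_pow_three ha hb hab
  have hbdbd : b * d * b * d = d * b * d * b := by
    have h : (b * d * b * d)⁻¹ = b * d * b * d :=
      inv_eq_of_mul_eq_one_right (by rw [← hbd]; simp only [pow_succ, pow_zero, one_mul, mul_assoc])
    rw [← h]
    simp only [mul_inv_rev, hb', hd', mul_assoc]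
  have h : a * b * a * d * b * d = d * b * a := by
    have h : (a * b * d * a * b * d)⁻¹ = a * b * d :=
      inv_eq_of_mul_eq_one_right (by rw [← habd]; simp only [pow_succ, pow_zero, one_mul, mul_assoc])
    calc a * b * a * d * b * d = a * b * (a * d) * b * d := by group
      _ = a * b * d * a * b * d := by rw [hcomm]; group
      _ = (a * b * d)⁻¹ := inv_eq_iff_eq_inv.1 h
      _ = d * b * a := by simp only [mul_inv_rev, ha', hb', hd', mul_assoc]
  calc a * (b * d * b) = b⁻¹ * (b * a * b * d * b * d) * d⁻¹ := by group
    _ = b * (d * b * a) * d := by rw [← hbraid, h, hb', hd']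
    _ = b * d * b * (a * d) := by group
    _ = b * d * b * d * a := by rw [hcomm]; group
    _ = d * (b * d * b) * a := by rw [hbdbd]; group

theorem mem_stabilizer_mul {g : G} {R T : Set G} (hR : R.Finite) (hT : T.Finite)
    (h : ∀ r ∈ R, ∃ r' ∈ R, ∃ k ∈ MulAction.stabilizer G T, g * r = r' * k) :
    g ∈ MulAction.stabilizer G (R * T) := by
  rw [MulAction.mem_stabilizer_set' (hR.mul hT)]
  rintro _ ⟨r, hr, t, ht, rfl⟩
  obtain ⟨r', hr', k, hk, e⟩ := h r hr
  refine ⟨r', hr', k * t, (MulAction.mem_stabilizer_set.1 hk t).2 ht, ?_⟩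
  simp only [smul_eq_mul, ← mul_assoc, e]

theorem card_le_of_relations {a b c d : G} (hgen : Subgroup.closure {a, b, c, d} = ⊤)
    (ha : a ^ 2 = 1) (hb : b ^ 2 = 1) (hc : c ^ 2 = 1) (hd : d ^ 2 = 1)
    (hac : (a * c) ^ 2 = 1) (had : (a * d) ^ 2 = 1) (hcd : (c * d) ^ 2 = 1)
    (hab : (a * b) ^ 3 = 1) (hbc : (b * c) ^ 3 = 1) (hbd : (b * d) ^ 4 = 1)
    (habd : (a * b * d) ^ 3 = 1) (hcbd : (c * b * d) ^ 3 = 1) :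
    Finite G ∧ Nat.card G ≤ 96 := by
  have hcb : (c * b) ^ 3 = 1 := by
    rw [show c * b = c * (b * c) * c⁻¹ by group, conj_pow, hbc]; group
  have ha' := mul_self_of_sq ha
  have hb' := mul_self_of_sq hb
  have hc' := mul_self_of_sq hc
  have hd' := mul_self_of_sq hd
  have ac := commute_of_sq ha hc hac
  have ad := commute_of_sq ha hd had
  have cd := commute_of_sq hc hd hcd
  have bab := braid_of_pow_three ha hb hab
  have cbc := braid_of_pow_three hc hb hcb
  have ae := mul_conj_of_hemioctahedron ha hb hd had hab hbd habd
  have ce := mul_conj_of_hemioctahedron hc hb hd hcd hcb hbd hcbd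
  obtain ⟨e, he⟩ : ∃ e, e = b * d * b := ⟨_, rfl⟩
  rw [← he] at ae ce
  have be : b * e = d * b := by rw [he, ← mul_assoc, ← mul_assoc, hb', one_mul]
  have bd : b * d = e * b := by rw [he, mul_assoc _ b b, hb', mul_one]
  have he' : e * e = 1 := by
    rw [he, show b * d * b * (b * d * b) = b * d * (b * b) * d * b by group, hb', mul_one,
      mul_assoc b d d, hd', mul_one, hb']
  have de : d * e = e * d := by
    have h : (d * e) ^ 2 = 1 := by
      rw [he, ← mul_self_of_sq (a := (d * b) ^ 2) (by
        rw [← pow_mul, show d * b = d * (b * d) * d⁻¹ by group, conj_pow, hbd]; group)]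
      simp only [sq, mul_assoc]
    exact commute_of_sq hd (by rw [sq, he']) h
  set A : Set G := {1, a}
  set S : Set G := {1, b, a * b} * A
  set W : Set G := {1, c, b * c, a * b * c} * S
  set V : Set G := {1, d, e, d * e} * W
  have fA : A.Finite := by simp [A]
  have fS : S.Finite := Set.Finite.mul (by simp) fA
  have fW : W.Finite := Set.Finite.mul (by simp) fS
  have fV : V.Finite := Set.Finite.mul (by simp) fW
  have aA : a ∈ MulAction.stabilizer G A := by
    rw [MulAction.mem_stabilizer_set' fA]
    rintro _ (rfl | rfl) <;> simp [A, ha']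
  have aS : a ∈ MulAction.stabilizer G S := by
    refine mem_stabilizer_mul (by simp) fA ?_
    simp only [Set.mem_insert_iff, Set.mem_singleton_iff, forall_eq_or_imp, forall_eq]
    refine ⟨?_, ?_, ?_⟩
    · exact ⟨1, by simp, a, aA, by simp⟩
    · exact ⟨a * b, by simp, 1, one_mem _, by simp⟩
    · exact ⟨b, by simp, 1, one_mem _, by rw [← mul_assoc, ha']; simp⟩
  have bS : b ∈ MulAction.stabilizer G S := by
    refine mem_stabilizer_mul (by simp) fA ?_
    simp only [Set.mem_insert_iff, Set.mem_singleton_iff, forall_eq_or_imp, forall_eq]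
    refine ⟨?_, ?_, ?_⟩
    · exact ⟨b, by simp, 1, one_mem _, by simp⟩
    · exact ⟨1, by simp, 1, one_mem _, by simp [hb']⟩
    · exact ⟨a * b, by simp, a, aA, by rw [bab, mul_assoc]⟩
  have aW : a ∈ MulAction.stabilizer G W := by
    refine mem_stabilizer_mul (by simp) fS ?_
    simp only [Set.mem_insert_iff, Set.mem_singleton_iff, forall_eq_or_imp, forall_eq]
    refine ⟨?_, ?_, ?_, ?_⟩
    · exact ⟨1, by simp, a, aS, by simp⟩
    · exact ⟨c, by simp, a, aS, ac⟩
    · exact ⟨a * b * c, by simp, 1, one_mem _, by simp [mul_assoc]⟩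
    · exact ⟨b * c, by simp, 1, one_mem _, by simp [← mul_assoc, ha']⟩
  have bW : b ∈ MulAction.stabilizer G W := by
    refine mem_stabilizer_mul (by simp) fS ?_
    simp only [Set.mem_insert_iff, Set.mem_singleton_iff, forall_eq_or_imp, forall_eq]
    refine ⟨?_, ?_, ?_, ?_⟩
    · exact ⟨1, by simp, b, bS, by simp⟩
    · exact ⟨b * c, by simp, 1, one_mem _, by simp⟩
    · exact ⟨c, by simp, 1, one_mem _, by simp [← mul_assoc, hb']⟩
    · refine ⟨a * b * c, by simp, a, aS, ?_⟩
      rw [← mul_assoc, ← mul_assoc, ← bab, mul_assoc, ac, ← mul_assoc]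
  have cW : c ∈ MulAction.stabilizer G W := by
    refine mem_stabilizer_mul (by simp) fS ?_
    simp only [Set.mem_insert_iff, Set.mem_singleton_iff, forall_eq_or_imp, forall_eq]
    refine ⟨?_, ?_, ?_, ?_⟩
    · exact ⟨c, by simp, 1, one_mem _, by simp⟩
    · exact ⟨1, by simp, 1, one_mem _, by simp [hc']⟩
    · exact ⟨b * c, by simp, b, bS, by rw [← mul_assoc, cbc]⟩
    · refine ⟨a * b * c, by simp, b, bS, ?_⟩
      rw [← mul_assoc, ← mul_assoc, ← ac, mul_assoc, mul_assoc, ← mul_assoc c, cbc]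
      simp only [mul_assoc]
  have aV : a ∈ MulAction.stabilizer G V := by
    refine mem_stabilizer_mul (by simp) fW ?_
    simp only [Set.mem_insert_iff, Set.mem_singleton_iff, forall_eq_or_imp, forall_eq]
    refine ⟨?_, ?_, ?_, ?_⟩
    · exact ⟨1, by simp, a, aW, by simp⟩
    · exact ⟨d, by simp, a, aW, ad⟩
    · exact ⟨d * e, by simp, a, aW, ae⟩
    · refine ⟨e, by simp, a, aW, ?_⟩
      rw [← mul_assoc, ad, mul_assoc, ae, ← mul_assoc, ← mul_assoc, hd', one_mul]
  have bV : b ∈ MulAction.stabilizer G V := by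
    refine mem_stabilizer_mul (by simp) fW ?_
    simp only [Set.mem_insert_iff, Set.mem_singleton_iff, forall_eq_or_imp, forall_eq]
    refine ⟨?_, ?_, ?_, ?_⟩
    · exact ⟨1, by simp, b, bW, by simp⟩
    · exact ⟨e, by simp, b, bW, bd⟩
    · exact ⟨d, by simp, b, bW, be⟩
    · exact ⟨d * e, by simp, b, bW, by rw [← mul_assoc, bd, mul_assoc, be, ← mul_assoc, de]⟩
  have cV : c ∈ MulAction.stabilizer G V := by
    refine mem_stabilizer_mul (by simp) fW ?_
    simp only [Set.mem_insert_iff, Set.mem_singleton_iff, forall_eq_or_imp, forall_eq]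
    refine ⟨?_, ?_, ?_, ?_⟩
    · exact ⟨1, by simp, c, cW, by simp⟩
    · exact ⟨d, by simp, c, cW, cd⟩
    · exact ⟨d * e, by simp, c, cW, ce⟩
    · refine ⟨e, by simp, c, cW, ?_⟩
      rw [← mul_assoc, cd, mul_assoc, ce, ← mul_assoc, ← mul_assoc, hd', one_mul]
  have dV : d ∈ MulAction.stabilizer G V := by
    refine mem_stabilizer_mul (by simp) fW ?_
    simp only [Set.mem_insert_iff, Set.mem_singleton_iff, forall_eq_or_imp, forall_eq]
    refine ⟨?_, ?_, ?_, ?_⟩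
    · exact ⟨d, by simp, 1, one_mem _, by simp⟩
    · exact ⟨1, by simp, 1, one_mem _, by simp [hd']⟩
    · exact ⟨d * e, by simp, 1, one_mem _, by simp⟩
    · exact ⟨e, by simp, 1, one_mem _, by rw [← mul_assoc, hd']; simp⟩
  have top : MulAction.stabilizer G V = ⊤ := by
    rw [eq_top_iff, ← hgen, Subgroup.closure_le]
    rintro _ (rfl | rfl | rfl | rfl) <;> assumption
  have one : (1 : G) ∈ V :=
    ⟨1, by simp, 1, ⟨1, by simp, 1, ⟨1, by simp, 1, by simp [A], by simp⟩, by simp⟩, by simp⟩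
  have univ : V = Set.univ := by
    refine Set.eq_univ_of_forall fun g ↦ ?_
    have hg : g ∈ MulAction.stabilizer G V := top ▸ Subgroup.mem_top g
    simpa using (MulAction.mem_stabilizer_set.1 hg 1).2 one
  refine ⟨Set.finite_univ_iff.1 (univ ▸ fV), ?_⟩
  have pair (x y : G) : ({x, y} : Set G).ncard ≤ 2 :=
    (Set.ncard_insert_le _ _).trans (by rw [Set.ncard_singleton])
  have two : A.ncard ≤ 2 := pair _ _
  have three : ({1, b, a * b} : Set G).ncard ≤ 3 :=
    (Set.ncard_insert_le _ _).trans (Nat.succ_le_succ (pair _ _))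
  have four (x y z : G) : ({1, x, y, z} : Set G).ncard ≤ 4 :=
    (Set.ncard_insert_le _ _).trans (Nat.succ_le_succ <|
      (Set.ncard_insert_le _ _).trans (Nat.succ_le_succ (pair _ _)))
  calc Nat.card G = V.ncard := by rw [univ, Set.ncard_univ]
    _ ≤ 4 * (4 * (3 * 2)) :=
      Set.natCard_mul_le.trans <| Nat.mul_le_mul (four _ _ _) <|
        Set.natCard_mul_le.trans <| Nat.mul_le_mul (four _ _ _) <|
          Set.natCard_mul_le.trans <| Nat.mul_le_mul three two

end Group

/-- The images of the generators in `S₄ × S₄`. They generate the fibre product of two copies of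
`S₄` over `S₃`. -/
def permGen : Fin 4 → Equiv.Perm (Fin 4) × Equiv.Perm (Fin 4) :=
  ![(Equiv.swap 0 1, Equiv.swap 0 1), (Equiv.swap 1 2, Equiv.swap 1 2),
    (Equiv.swap 2 3, Equiv.swap 0 1), (1, Equiv.swap 0 1 * Equiv.swap 2 3)]

theorem lift_permGen_eq_one : ∀ r ∈ tomotopeRels, FreeGroup.lift permGen r = 1 := by
  simp only [tomotopeRels, Set.mem_insert_iff, Set.mem_singleton_iff, forall_eq_or_imp, forall_eq,
    ρ, map_pow, map_mul, FreeGroup.lift_apply_of]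
  refine ⟨?_, ?_, ?_, ?_, ?_, ?_, ?_, ?_, ?_, ?_, ?_, ?_⟩ <;> decide

/-- The representation of the tomotope group in `S₄ × S₄`. -/
def permHom : PresentedGroup tomotopeRels →* Equiv.Perm (Fin 4) × Equiv.Perm (Fin 4) :=
  PresentedGroup.toGroup lift_permGen_eq_one

theorem permHom_of (i : Fin 4) : permHom (PresentedGroup.of i) = permGen i :=
  PresentedGroup.toGroup.of lift_permGen_eq_one

theorem fst_permHom_surjective :
    Function.Surjective ((MonoidHom.fst _ _).comp permHom) := by
  rw [← MonoidHom.mrange_eq_top, eq_top_iff, ← Equiv.Perm.mclosure_swap_castSucc_succ 3,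
    Submonoid.closure_le]
  rintro _ ⟨i, rfl⟩
  exact ⟨PresentedGroup.of i.castSucc, by
    rw [MonoidHom.comp_apply, permHom_of]; revert i; decide⟩

theorem four_le_card_ker [Finite (PresentedGroup tomotopeRels)] :
    4 ≤ Nat.card ((MonoidHom.fst _ _).comp permHom).ker := by
  let d : PresentedGroup tomotopeRels := PresentedGroup.of 3
  let e : PresentedGroup tomotopeRels := PresentedGroup.of 1 * d * PresentedGroup.of 1
  let f : Fin 4 → PresentedGroup tomotopeRels := ![1, d, e, d * e]
  let F : Fin 4 → Equiv.Perm (Fin 4) × Equiv.Perm (Fin 4) :=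
    ![1, permGen 3, permGen 1 * permGen 3 * permGen 1,
      permGen 3 * (permGen 1 * permGen 3 * permGen 1)]
  have hf (i : Fin 4) : permHom (f i) = F i := by
    fin_cases i <;> simp [f, F, d, e, permHom_of]
  have hF : Function.Injective F := by decide
  have hF' : ∀ i, (F i).1 = 1 := by decide
  have hinj : Function.Injective
      (fun i ↦ (⟨f i, by rw [MonoidHom.mem_ker, MonoidHom.comp_apply, hf]; exact hF' i⟩ :
        ((MonoidHom.fst _ _).comp permHom).ker)) := fun i j hij ↦ hF <| by
    rw [← hf, ← hf]
    exact congrArg permHom (congrArg Subtype.val hij)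
  simpa using Nat.card_le_card_of_injective _ hinj

/-- The group of the tomotope (the quotient of the affine Coxeter group `B̃₃` by the
relations `(ρ₀ρ₁ρ₃)³ = (ρ₂ρ₁ρ₃)³ = 1`) is a finite group of order `96`. -/
theorem tomotope_group_card :
    Finite (PresentedGroup tomotopeRels) ∧ Nat.card (PresentedGroup tomotopeRels) = 96 := by
  have hrel {r : FreeGroup (Fin 4)} (hr : r ∈ tomotopeRels) :
      PresentedGroup.mk tomotopeRels r = 1 :=
    PresentedGroup.one_of_mem hr
  have hgen : Subgroup.closure {PresentedGroup.mk tomotopeRels (ρ 0),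
      PresentedGroup.mk tomotopeRels (ρ 1), PresentedGroup.mk tomotopeRels (ρ 2),
      PresentedGroup.mk tomotopeRels (ρ 3)} = ⊤ := by
    rw [eq_top_iff, ← PresentedGroup.closure_range_of, Subgroup.closure_le]
    rintro _ ⟨i, rfl⟩
    apply Subgroup.subset_closure
    fin_cases i <;> simp [PresentedGroup.of, ρ]
  obtain ⟨hfin, hle⟩ : Finite (PresentedGroup tomotopeRels) ∧
      Nat.card (PresentedGroup tomotopeRels) ≤ 96 := by
    apply card_le_of_relations hgen <;> simp only [← map_mul, ← map_pow] <;>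
      exact hrel (by simp [tomotopeRels])
  refine ⟨hfin, hle.antisymm ?_⟩
  have hindex : ((MonoidHom.fst _ _).comp permHom).ker.index = 24 := by
    rw [Subgroup.index_ker, MonoidHom.range_eq_top.2 fst_permHom_surjective, Subgroup.card_top,
      Nat.card_perm, Nat.card_fin]
    rfl
  rw [← ((MonoidHom.fst _ _).comp permHom).ker.card_mul_index, hindex]
  exact Nat.mul_le_mul_right 24 four_le_card_ker

end Tomotope
end

section
/- In the symmetric group on {1, …, 12}, let σ_0 = (5 10)(6 9)(7 12)(8 11), σ_1 = (1 6)(2 5)(3 8)(4 7), σ_2 = (5 9)(6 10)(7 11)(8 12), and σ_3 = (5 8)(6 7)(9 12)(10 11). Then the permutations σ_0, σ_1, σ_2, σ_3 satisfy the relations σ_i² = (σ_0σ_2)² = (σ_0σ_3)² = (σ_2σ_3)² = (σ_0σ_1)³ = (σ_1σ_2)³ = (σ_1σ_3)⁴ = (σ_0σ_1σ_3)³ = (σ_2σ_1σ_3)³ = 1, and the subgroup of the symmetric group they generate has order 96; consequently the induced homomorphism from the presented group on ρ_0, ρ_1, ρ_2, ρ_3 with these relations (the tomotope group) sending ρ_i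 ↦ σ_i is an isomorphism onto ⟨σ_0, σ_1, σ_2, σ_3⟩. -/
namespace Tomotope

/-- The permutations `σ 0 = (5 10)(6 9)(7 12)(8 11)`, `σ 1 = (1 6)(2 5)(3 8)(4 7)`,
`σ 2 = (5 9)(6 10)(7 11)(8 12)`, `σ 3 = (5 8)(6 7)(9 12)(10 11)` of `{1, …, 12}`,
written zero-indexed as permutations of `Fin 12`. -/
def σ : Fin 4 → Equiv.Perm (Fin 12)
  | 0 => Equiv.swap 4 9 * Equiv.swap 5 8 * Equiv.swap 6 11 * Equiv.swap 7 10
  | 1 => Equiv.swap 0 5 * Equiv.swap 1 4 * Equiv.swap 2 7 * Equiv.swap 3 6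
  | 2 => Equiv.swap 4 8 * Equiv.swap 5 9 * Equiv.swap 6 10 * Equiv.swap 7 11
  | 3 => Equiv.swap 4 7 * Equiv.swap 5 6 * Equiv.swap 8 11 * Equiv.swap 9 10

section NormalForm

variable {G H : Type*} [Group G] [Group H]

/-- The words representing the twelve cosets of the subgroup generated by `g 0`, `g 2`, `g 3`. -/
def edgeWord (g : Fin 4 → G) : Fin 12 → G :=
  ![1, g 1, g 0 * g 1, g 2 * g 1, g 3 * g 1, g 0 * g 2 * g 1, g 0 * g 3 * g 1, g 2 * g 3 * g 1,
    g 0 * g 2 * g 3 * g 1, g 1 * g 3 * g 1, g 1 * g 0 * g 2 * g 1, g 1 * g 0 * g 2 * g 3 * g 1]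

/-- The words representing the elements of the subgroup generated by `g 0`, `g 2`, `g 3`. -/
def stabilizerWord (g : Fin 4 → G) (e : Bool × Bool × Bool) : G :=
  (bif e.1 then g 0 else 1) * (bif e.2.1 then g 2 else 1) * (bif e.2.2 then g 3 else 1)

/-- The normal form of an element of a group satisfying the relations of the tomotope group. -/
def normalForm (g : Fin 4 → G) (t : Fin 12 × Bool × Bool × Bool) : G :=
  edgeWord g t.1 * stabilizerWord g t.2

theorem map_normalForm (f : G →* H) (g : Fin 4 → G) (t : Fin 12 × Bool × Bool × Bool) :
    f (normalForm g t) = normalForm (fun i => f (g i)) t := by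
  obtain ⟨i, x, y, z⟩ := t
  rw [normalForm, map_mul, normalForm]
  congr 1
  · fin_cases i <;> simp [edgeWord]
  · cases x <;> cases y <;> cases z <;> simp [stabilizerWord]

theorem normalForm_mem_closure (g : Fin 4 → G) (t : Fin 12 × Bool × Bool × Bool) :
    normalForm g t ∈ Subgroup.closure (Set.range g) := by
  have hg (i : Fin 4) : g i ∈ Subgroup.closure (Set.range g) :=
    Subgroup.subset_closure (Set.mem_range_self i)
  have h := map_normalForm (Subgroup.closure (Set.range g)).subtype (fun i => ⟨g i, hg i⟩) t
  exact h ▸ SetLike.coe_mem _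

/-- The action of the generators on the twelve cosets represented by `edgeWord`. -/
def edgeAction : Fin 4 → Fin 12 → Fin 12 :=
  ![![0, 2, 1, 5, 6, 3, 4, 8, 7, 9, 10, 11],
    ![1, 0, 2, 3, 9, 10, 6, 7, 11, 4, 5, 8],
    ![0, 3, 5, 1, 7, 2, 8, 4, 6, 9, 10, 11],
    ![0, 4, 6, 7, 1, 8, 2, 3, 5, 9, 10, 11]]

/-- The exponents of the element of the subgroup generated by `g 0`, `g 2`, `g 3` that appears
when a generator moves a coset representative. -/
def edgeCocycle : Fin 4 → Fin 12 → Bool × Bool × Bool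
  | 0, 0 => (true, false, false)
  | 0, 9 => (true, false, true)
  | 0, 10 => (false, true, false)
  | 0, 11 => (false, true, true)
  | 1, 2 => (true, false, false)
  | 1, 3 => (false, true, false)
  | 1, 6 => (true, false, true)
  | 1, 7 => (false, true, true)
  | 2, 0 => (false, true, false)
  | 2, 9 => (false, true, true)
  | 2, 10 => (true, false, false)
  | 2, 11 => (true, false, true)
  | 3, 0 => (false, false, true)
  | 3, 9 => (false, false, true)
  | 3, 10 => (false, false, true)
  | 3, 11 => (false, false, true)
  | _, _ => (false, false, false)

theorem lift_pow_eq_one {g : Fin 4 → G} (hg : ∀ r ∈ tomotopeRels, FreeGroup.lift g r = 1)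
    {w : FreeGroup (Fin 4)} {n : ℕ} (hw : w ^ n ∈ tomotopeRels) :
    FreeGroup.lift g w ^ n = 1 := by
  rw [← map_pow, hg _ hw]

theorem generator_mul_self {g : Fin 4 → G} (hg : ∀ r ∈ tomotopeRels, FreeGroup.lift g r = 1)
    (i : Fin 4) : g i * g i = 1 := by
  have h := hg (ρ i ^ 2) (by fin_cases i <;> simp [tomotopeRels])
  simpa [ρ, pow_two] using h

theorem commute_of_mul_sq_eq_one {u v : G} (hu : u * u = 1) (hv : v * v = 1)
    (h : (u * v) ^ 2 = 1) : Commute u v := by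
  have huv := mul_eq_one_iff_eq_inv.mp (pow_two (u * v) ▸ h)
  rwa [mul_inv_rev, ← mul_eq_one_iff_eq_inv.mp hu, ← mul_eq_one_iff_eq_inv.mp hv] at huv

theorem generators_commute {g : Fin 4 → G} (hg : ∀ r ∈ tomotopeRels, FreeGroup.lift g r = 1) :
    Commute (g 0) (g 2) ∧ Commute (g 0) (g 3) ∧ Commute (g 2) (g 3) := by
  have sq := generator_mul_self hg
  refine ⟨commute_of_mul_sq_eq_one (sq 0) (sq 2) ?_, commute_of_mul_sq_eq_one (sq 0) (sq 3) ?_,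
    commute_of_mul_sq_eq_one (sq 2) (sq 3) ?_⟩
  · simpa [ρ] using lift_pow_eq_one hg (w := ρ 0 * ρ 2) (n := 2) (by simp [tomotopeRels])
  · simpa [ρ] using lift_pow_eq_one hg (w := ρ 0 * ρ 3) (n := 2) (by simp [tomotopeRels])
  · simpa [ρ] using lift_pow_eq_one hg (w := ρ 2 * ρ 3) (n := 2) (by simp [tomotopeRels])

theorem stabilizerWord_mul {g : Fin 4 → G} (hg : ∀ r ∈ tomotopeRels, FreeGroup.lift g r = 1)
    (e e' : Bool × Bool × Bool) :
    stabilizerWord g e * stabilizerWord g e' =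
      stabilizerWord g (xor e.1 e'.1, xor e.2.1 e'.2.1, xor e.2.2 e'.2.2) := by
  obtain ⟨c02, c03, c23⟩ := generators_commute hg
  have power_mul (i : Fin 4) (x y : Bool) :
      (bif x then g i else 1) * (bif y then g i else 1) = bif xor x y then g i else 1 := by
    cases x <;> cases y <;> simp [generator_mul_self hg]
  have power_comm {u v : G} (h : Commute u v) (x y : Bool) :
      Commute (bif x then v else 1) (bif y then u else 1) := by
    cases x <;> cases y <;> simp [h.symm]
  simp only [stabilizerWord]
  rw [((power_comm c03 _ _).mul_right (power_comm c23 _ _)).mul_mul_mul_comm,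
    (power_comm c02 _ _).mul_mul_mul_comm, power_mul, power_mul, power_mul]

/-- The braid relation, in right-associated form. -/
theorem braid_of_mul_pow_three {u v : G} (hu : u * u = 1) (hv : v * v = 1)
    (h : (u * v) ^ 3 = 1) (x : G) : v * (u * (v * x)) = u * (v * (u * x)) := by
  have cancel_u (y : G) : u * (u * y) = y := by rw [← mul_assoc, hu, one_mul]
  have cancel_v (y : G) : v * (v * y) = y := by rw [← mul_assoc, hv, one_mul]
  have hy := congrArg (· * (v * (u * (v * x)))) h
  simpa [pow_succ, mul_assoc, cancel_u, cancel_v] using hy.symm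

theorem mul_mul_mul_mul_of_pow_three {u v w : G} (hu : u * u = 1) (hv : v * v = 1)
    (hw : w * w = 1) (huw : Commute u w) (h : (u * v * w) ^ 3 = 1) (x : G) :
    v * (u * (w * (v * x))) = u * (w * (v * (u * (w * x)))) := by
  have cancel_u (y : G) : u * (u * y) = y := by rw [← mul_assoc, hu, one_mul]
  have cancel_v (y : G) : v * (v * y) = y := by rw [← mul_assoc, hv, one_mul]
  have cancel_w (y : G) : w * (w * y) = y := by rw [← mul_assoc, hw, one_mul]
  have swap_w (y : G) : w * (u * y) = u * (w * y) := huw.symm.left_comm y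
  have hy := congrArg (u * · * (w * (v * (u * (w * x))))) h
  simpa [pow_succ, mul_assoc, cancel_u, cancel_v, cancel_w, swap_w] using hy

theorem mul_mul_mul_mul_of_pow_four {v w : G} (hv : v * v = 1) (hw : w * w = 1)
    (h : (v * w) ^ 4 = 1) (x : G) : w * (v * (w * (v * x))) = v * (w * (v * (w * x))) := by
  have cancel_v (y : G) : v * (v * y) = y := by rw [← mul_assoc, hv, one_mul]
  have cancel_w (y : G) : w * (w * y) = y := by rw [← mul_assoc, hw, one_mul]
  have hy := congrArg (· * (w * (v * (w * (v * x))))) h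
  simpa [pow_succ, mul_assoc, cancel_v, cancel_w] using hy.symm

theorem generator_mul_edgeWord {g : Fin 4 → G}
    (hg : ∀ r ∈ tomotopeRels, FreeGroup.lift g r = 1) (j : Fin 4) (i : Fin 12) :
    g j * edgeWord g i = edgeWord g (edgeAction j i) * stabilizerWord g (edgeCocycle j i) := by
  obtain ⟨c02, c03, c23⟩ := generators_commute hg
  have sq := generator_mul_self hg
  have braid01 : (g 0 * g 1) ^ 3 = 1 := by
    simpa [ρ] using lift_pow_eq_one hg (w := ρ 0 * ρ 1) (n := 3) (by simp [tomotopeRels])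
  have braid21 : (g 2 * g 1) ^ 3 = 1 := by
    have h12 : (g 1 * g 2) ^ 3 = 1 := by
      simpa [ρ] using lift_pow_eq_one hg (w := ρ 1 * ρ 2) (n := 3) (by simp [tomotopeRels])
    have hinv := congrArg (·⁻¹) h12
    simpa [← inv_pow, ← mul_eq_one_iff_eq_inv.mp (sq _)] using hinv
  have rel13 : (g 1 * g 3) ^ 4 = 1 := by
    simpa [ρ] using lift_pow_eq_one hg (w := ρ 1 * ρ 3) (n := 4) (by simp [tomotopeRels])
  have rel013 : (g 0 * g 1 * g 3) ^ 3 = 1 := by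
    simpa [ρ] using lift_pow_eq_one hg (w := ρ 0 * ρ 1 * ρ 3) (n := 3) (by simp [tomotopeRels])
  have rel213 : (g 2 * g 1 * g 3) ^ 3 = 1 := by
    simpa [ρ] using lift_pow_eq_one hg (w := ρ 2 * ρ 1 * ρ 3) (n := 3) (by simp [tomotopeRels])
  replace braid01 := braid_of_mul_pow_three (sq 0) (sq 1) braid01
  replace braid21 := braid_of_mul_pow_three (sq 2) (sq 1) braid21
  replace rel13 := mul_mul_mul_mul_of_pow_four (sq 1) (sq 3) rel13
  replace rel013 := mul_mul_mul_mul_of_pow_three (sq 0) (sq 1) (sq 3) c03 rel013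
  replace rel213 := mul_mul_mul_mul_of_pow_three (sq 2) (sq 1) (sq 3) c23 rel213
  have cancel (k : Fin 4) (x : G) : g k * (g k * x) = x := by rw [← mul_assoc, sq, one_mul]
  have swap02 (x : G) : g 2 * (g 0 * x) = g 0 * (g 2 * x) := c02.symm.left_comm x
  have swap03 (x : G) : g 3 * (g 0 * x) = g 0 * (g 3 * x) := c03.symm.left_comm x
  have swap23 (x : G) : g 3 * (g 2 * x) = g 2 * (g 3 * x) := c23.symm.left_comm x
  have mul0_word9 (x : G) :
      g 0 * (g 1 * (g 3 * (g 1 * x))) = g 1 * (g 3 * (g 1 * (g 0 * (g 3 * x)))) := by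
    have h := braid01 (g 0 * (g 3 * (g 1 * x)))
    rw [rel013, cancel, cancel] at h
    exact h.symm
  have mul2_word9 (x : G) :
      g 2 * (g 1 * (g 3 * (g 1 * x))) = g 1 * (g 3 * (g 1 * (g 2 * (g 3 * x)))) := by
    have h := braid21 (g 2 * (g 3 * (g 1 * x)))
    rw [rel213, cancel, cancel] at h
    exact h.symm
  have mul0_word10 (x : G) :
      g 0 * (g 1 * (g 0 * (g 2 * (g 1 * x)))) = g 1 * (g 0 * (g 2 * (g 1 * (g 2 * x)))) := by
    rw [← braid01, braid21]
  have mul2_word10 (x : G) :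
      g 2 * (g 1 * (g 0 * (g 2 * (g 1 * x)))) = g 1 * (g 0 * (g 2 * (g 1 * (g 0 * x)))) := by
    rw [← swap02, ← braid21, braid01, swap02]
  have mul0_word11 (x : G) :
      g 0 * (g 1 * (g 0 * (g 2 * (g 3 * (g 1 * x))))) =
        g 1 * (g 0 * (g 2 * (g 3 * (g 1 * (g 2 * (g 3 * x)))))) := by
    rw [← braid01, rel213]
  have mul2_word11 (x : G) :
      g 2 * (g 1 * (g 0 * (g 2 * (g 3 * (g 1 * x))))) =
        g 1 * (g 0 * (g 2 * (g 3 * (g 1 * (g 0 * (g 3 * x)))))) := by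
    rw [← swap02, ← braid21, rel013, swap02]
  have move3 (x : G) : g 3 * (g 1 * (g 0 * (g 3 * x))) =
      g 1 * (g 0 * (g 1 * (g 3 * (g 1 * x)))) := by
    have h := rel013 (g 1 * x)
    rw [cancel] at h
    rw [h, swap03, cancel, ← braid01]
  have mul3_word11 (x : G) :
      g 3 * (g 1 * (g 0 * (g 2 * (g 3 * (g 1 * x))))) =
        g 1 * (g 0 * (g 2 * (g 3 * (g 1 * (g 3 * x))))) := by
    rw [← swap23, move3, braid21, swap23, rel213]
    simp only [swap23, cancel]
  have mul3_word10 (x : G) :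
      g 3 * (g 1 * (g 0 * (g 2 * (g 1 * x)))) =
        g 1 * (g 0 * (g 2 * (g 1 * (g 3 * x)))) := by
    rw [← cancel 3 (g 2 * (g 1 * x)), move3, ← rel13, braid21, swap23, rel213]
    simp only [swap23, cancel]
  have mul_edgeWord (x : G) : g j * (edgeWord g i * x) =
      edgeWord g (edgeAction j i) * (stabilizerWord g (edgeCocycle j i) * x) := by
    fin_cases j <;> fin_cases i <;>
      simp [edgeWord, edgeAction, edgeCocycle, stabilizerWord, mul_assoc, cancel, swap02, swap03,
        swap23, braid01, braid21, rel13, rel013, rel213, mul0_word9, mul2_word9, mul0_word10,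
        mul2_word10, mul3_word10, mul0_word11, mul2_word11, mul3_word11]
  simpa using mul_edgeWord 1

theorem range_normalForm {g : Fin 4 → G} (hg : ∀ r ∈ tomotopeRels, FreeGroup.lift g r = 1) :
    Set.range (normalForm g) = Subgroup.closure (Set.range g) := by
  refine Set.Subset.antisymm (Set.range_subset_iff.mpr (normalForm_mem_closure g)) fun x hx => ?_
  have hmul (j : Fin 4) (y : G) (hy : y ∈ Set.range (normalForm g)) :
      g j * y ∈ Set.range (normalForm g) := by
    obtain ⟨⟨i, e⟩, rfl⟩ := hy
    exact ⟨(edgeAction j i, _), by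
      rw [normalForm, normalForm, ← mul_assoc, generator_mul_edgeWord hg, mul_assoc,
        stabilizerWord_mul hg]⟩
  induction hx using Subgroup.closure_induction_left with
  | one => exact ⟨(0, false, false, false), by simp [normalForm, edgeWord, stabilizerWord]⟩
  | mul_left x hx y _ ih =>
    obtain ⟨j, rfl⟩ := hx
    exact hmul j y ih
  | inv_mul_cancel x hx y _ ih =>
    obtain ⟨j, rfl⟩ := hx
    rw [← mul_eq_one_iff_eq_inv.mp (generator_mul_self hg j)]
    exact hmul j y ih

end NormalForm

theorem lift_σ_eq_one : ∀ r ∈ tomotopeRels, FreeGroup.lift σ r = 1 := by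
  simp only [tomotopeRels, Set.mem_insert_iff, Set.mem_singleton_iff, forall_eq_or_imp,
    forall_eq, ρ, map_pow, map_mul, FreeGroup.lift_apply_of]
  decide +kernel

theorem normalForm_σ_injective : Function.Injective (normalForm σ) := by
  have stabilizer_fix : ∀ e, stabilizerWord σ e 0 = 0 := by decide
  have edge_injective : Function.Injective fun i => edgeWord σ i 0 := by decide
  have stabilizer_injective : Function.Injective fun e => stabilizerWord σ e 4 := by decide
  rintro ⟨i, e⟩ ⟨i', e'⟩ h
  have hi : i = i' := edge_injective <| by
    simpa [normalForm, stabilizer_fix] using DFunLike.congr_fun h 0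
  subst hi
  exact Prod.ext rfl <| stabilizer_injective <|
    congrArg (fun p : Equiv.Perm (Fin 12) => p 4) (mul_left_cancel h)

/-- The permutations `σ 0, σ 1, σ 2, σ 3` satisfy the defining relations of the tomotope
group, the subgroup they generate has order `96`, and the induced homomorphism from the
presented group (the tomotope group), sending `ρ i` to `σ i`, is an isomorphism onto
`⟨σ 0, σ 1, σ 2, σ 3⟩`. -/
theorem tomotope_permutation_representation :
    (∀ r ∈ tomotopeRels, FreeGroup.lift σ r = 1) ∧
    Nat.card (Subgroup.closure (Set.range σ)) = 96 ∧
    ∀ h : ∀ r ∈ tomotopeRels, FreeGroup.lift σ r = 1,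
      Function.Injective (PresentedGroup.toGroup h) ∧
      (PresentedGroup.toGroup h).range = Subgroup.closure (Set.range σ) := by
  refine ⟨lift_σ_eq_one, ?_, fun h => ⟨?_, ?_⟩⟩
  · have hcard := Nat.card_range_of_injective normalForm_σ_injective
    rw [range_normalForm lift_σ_eq_one] at hcard
    simpa using hcard
  · have hof : ∀ r ∈ tomotopeRels,
        FreeGroup.lift (PresentedGroup.of (rels := tomotopeRels)) r = 1 := by
      have hlift : FreeGroup.lift PresentedGroup.of = PresentedGroup.mk tomotopeRels :=
        FreeGroup.ext_hom _ _ fun i => FreeGroup.lift_apply_of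
      intro r hr
      rw [hlift, PresentedGroup.one_of_mem hr]
    have hsurj : Function.Surjective (normalForm (PresentedGroup.of (rels := tomotopeRels))) := by
      rw [← Set.range_eq_univ, range_normalForm hof, PresentedGroup.closure_range_of,
        Subgroup.coe_top]
    refine Function.Injective.of_comp_right (f := PresentedGroup.toGroup h) ?_ hsurj
    convert normalForm_σ_injective using 1
    funext t
    simp [map_normalForm]
  · rw [MonoidHom.range_eq_map, ← PresentedGroup.closure_range_of, MonoidHom.map_closure,
      ← Set.range_comp]
    congr 2

end Tomotope
end
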